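/- arXiv:1607.03010 — 3 statements merged into one kernel-verified Lean document; each statement's English description precedes it below -/
import Mathlib

section
/- Let G_α, α ∈ I, be nontrivial left ordered groups, each equipped with a left-invariant linear order ≤_α, and let 𝓕 = *_{α∈I} G_α be their free product. Then there exists a linear order ⪯ on 𝓕 that is left invariant (a ⪯ b implies ca ⪯ cb for all a, b, c ∈ 𝓕) and extends the orders on the factors, i.e., for every α ∈ I and g, h ∈ G_α, g ≤_α h if and only if ι_α(g) ⪯ ι_α(h), where ι_α : G_α → 𝓕 is the canonical inclusion. -/
open Monoid

namespace FreeProdOrder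

section
variable {I : Type*} {G : I → Type*} [∀ i, Group (G i)]

/-- The sign of a transition between two indices. -/
def jump [LinearOrder I] : Option I → Option I → ℤ
  | some i, some j => if i < j then 1 else if j < i then -1 else 0
  | _, _ => 0

/-- The sign of an element of an ordered group. -/
def sg {H : Type*} [Group H] [LinearOrder H] (g : H) : ℤ :=
  if 1 < g then 1 else if g < 1 then -1 else 0

/-- The weight of a list of syllables. -/
def tauL [LinearOrder I] [∀ i, LinearOrder (G i)] : List (Σ i, G i) → ℤ
  | [] => 0
  | x :: l => sg x.2 + jump (some x.1) (l.head?.map Sigma.fst) + tauL l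

/-- The weight of a reduced word. -/
def tau [LinearOrder I] [∀ i, LinearOrder (G i)] (w : CoprodI.Word G) : ℤ := tauL w.toList

theorem tau_cons [LinearOrder I] [∀ i, LinearOrder (G i)] {i : I} (g : G i)
    (w : CoprodI.Word G) (h1 : w.fstIdx ≠ some i) (h2 : g ≠ 1) :
    tau (CoprodI.Word.cons g w h1 h2) = sg g + jump (some i) w.fstIdx + tau w := rfl

theorem tau_empty [LinearOrder I] [∀ i, LinearOrder (G i)] :
    tau (CoprodI.Word.empty : CoprodI.Word G) = 0 := rfl

theorem jump_anti [LinearOrder I] (a b : Option I) : jump a b = - jump b a := by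
  rcases a with _ | a <;> rcases b with _ | b <;> simp only [jump] <;> try simp
  grind

theorem jump_none [LinearOrder I] (a : Option I) : jump a none = 0 := by
  cases a <;> rfl

theorem jump_tri [LinearOrder I] (a b : Option I) (k : I) (ha : a ≠ some k) (hb : b ≠ some k)
    (hab : a ≠ b) :
    |jump a b - jump (some k) b + jump (some k) a| ≤ 1 := by
  rw [abs_le]
  rcases a with _ | a <;> rcases b with _ | b <;> simp only [jump] <;> grind

theorem jump_odd [LinearOrder I] (a b : I) (h : a ≠ b) : Odd (jump (some a) (some b)) := by
  simp only [jump]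
  rcases lt_or_gt_of_ne h with h | h
  · simp [h]
  · simp [h, h.not_gt]

section sg
variable {H : Type*} [Group H] [LinearOrder H]

theorem lt_iff (hl : ∀ a b c : H, a ≤ b → c * a ≤ c * b)
    (a b c : H) : c * a < c * b ↔ a < b := by
  rw [← not_le, ← not_le, not_iff_not]
  refine ⟨fun h => ?_, hl _ _ _⟩
  simpa using hl _ _ c⁻¹ h

theorem sg_div (hl : ∀ a b c : H, a ≤ b → c * a ≤ c * b)
    (g h : H) : sg (g⁻¹ * h) = if g < h then 1 else if h < g then -1 else 0 := by
  have h1 := lt_iff hl 1 (g⁻¹ * h) g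
  have h2 := lt_iff hl (g⁻¹ * h) 1 g
  simp only [mul_one, mul_inv_cancel_left] at h1 h2
  simp only [sg, h1, h2]

theorem sg_inv (hl : ∀ a b c : H, a ≤ b → c * a ≤ c * b)
    (g : H) : sg g⁻¹ = - sg g := by
  have := sg_div hl g 1
  rw [mul_one] at this
  rw [this, sg]
  grind

theorem sg_tri (hl : ∀ a b c : H, a ≤ b → c * a ≤ c * b)
    (g h : H) (hg : g ≠ 1) (hh : h ≠ 1) (hgh : g ≠ h) :
    |sg (g⁻¹ * h) - sg h + sg g| ≤ 1 := by
  rw [sg_div hl, abs_le]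
  simp only [sg]
  grind

end sg

theorem sg_odd {H : Type*} [Group H] [LinearOrder H] (g : H) (hg : g ≠ 1) : Odd (sg g) := by
  simp only [sg]
  rcases lt_or_gt_of_ne hg with h | h
  · simp [h, h.not_gt]
  · simp [h]

open scoped Classical in
theorem tau_odd [LinearOrder I] [∀ i, LinearOrder (G i)] (w : CoprodI.Word G) :
    w ≠ CoprodI.Word.empty → Odd (tau w) := by
  induction w using CoprodI.Word.consRecOn with
  | empty => simp
  | cons i g w h1 h2 ih =>
    intro _
    rw [tau_cons]
    by_cases hw : w = CoprodI.Word.empty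
    · subst hw
      rw [tau_empty]
      change Odd (sg g + 0 + 0)
      simpa using sg_odd g h2
    · have h3 := ih hw
      have h4 : Odd (jump (some i) w.fstIdx) := by
        cases hf : w.fstIdx with
        | none =>
          exfalso; apply hw
          ext1
          simpa [CoprodI.Word.fstIdx] using hf
        | some j => exact jump_odd _ _ (by rintro rfl; exact h1 hf)
      exact ((sg_odd g h2).add_odd h4).add_odd h3

open scoped Classical in
theorem key [LinearOrder I] [∀ i, LinearOrder (G i)]
    (hl : ∀ i, ∀ a b c : G i, a ≤ b → c * a ≤ c * b) (p : CoprodI.Word G) :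
    ∀ q : CoprodI.Word G,
      (p.fstIdx ≠ q.fstIdx →
        tau (p.prod⁻¹ • q) = tau q - tau p + jump p.fstIdx q.fstIdx) ∧
      |tau (p.prod⁻¹ • q) - tau q + tau p| ≤ 1 := by
  have aux : ∀ a b : Option I, |jump a b| ≤ 1 := by
    intro a b
    rw [abs_le]
    rcases a with _ | a <;> rcases b with _ | b <;> simp only [jump] <;> grind
  induction p using CoprodI.Word.consRecOn with
  | empty =>
    intro q
    have e : jump (CoprodI.Word.empty : CoprodI.Word G).fstIdx q.fstIdx = 0 := rfl
    rw [CoprodI.Word.prod_empty, inv_one, one_smul, tau_empty, e]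
    simp
  | cons k g p h1 h2 ih =>
    intro q
    have hg : g⁻¹ ≠ 1 := by simpa using h2
    have e : (CoprodI.Word.cons g p h1 h2).prod⁻¹ • q
        = p.prod⁻¹ • ((CoprodI.of g⁻¹ : CoprodI G) • q) := by
      rw [CoprodI.Word.prod_cons, mul_inv_rev, mul_smul, map_inv]
    rw [e, tau_cons, CoprodI.Word.fstIdx_cons]
    by_cases hq : q.fstIdx = some k
    · refine ⟨fun h => absurd hq.symm h, ?_⟩
      induction q using CoprodI.Word.consRecOn with
      | empty => simp [CoprodI.Word.fstIdx, CoprodI.Word.empty] at hq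
      | cons j h q h3 h4 _ =>
        rw [CoprodI.Word.fstIdx_cons] at hq
        obtain rfl : j = k := by simpa using hq
        rw [tau_cons, CoprodI.Word.cons_eq_smul,
          ← mul_smul (CoprodI.of g⁻¹) (CoprodI.of h), ← map_mul]
        by_cases hgh : g = h
        · subst hgh
          rw [inv_mul_cancel, map_one, one_smul]
          by_cases hpq : p.fstIdx = q.fstIdx
          · have := (ih q).2
            rw [hpq]
            convert this using 2
            ring
          · rw [(ih q).1 hpq]
            convert jump_tri _ _ j h1 h3 hpq using 2
            ring
        · have h5 : g⁻¹ * h ≠ 1 := by rwa [ne_eq, inv_mul_eq_one]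
          rw [← CoprodI.Word.cons_eq_smul (h1 := h3) (h2 := h5)]
          rw [(ih _).1 (by rwa [CoprodI.Word.fstIdx_cons]), tau_cons, CoprodI.Word.fstIdx_cons,
            jump_anti p.fstIdx]
          convert sg_tri (hl j) g h h2 h4 hgh using 2
          ring
    · rw [← CoprodI.Word.cons_eq_smul (h1 := hq) (h2 := hg)]
      rw [(ih _).1 (by rwa [CoprodI.Word.fstIdx_cons]), tau_cons, CoprodI.Word.fstIdx_cons,
        jump_anti p.fstIdx, sg_inv (hl k)]
      refine ⟨fun _ => by ring, ?_⟩
      convert aux (some k) q.fstIdx using 2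
      ring

open scoped Classical in
/-- The weight on the free product. -/
noncomputable def T [LinearOrder I] [∀ i, LinearOrder (G i)] (x : CoprodI G) : ℤ :=
  tau (CoprodI.Word.equiv x)

open scoped Classical in
theorem T_mul [LinearOrder I] [∀ i, LinearOrder (G i)]
    (hl : ∀ i, ∀ a b c : G i, a ≤ b → c * a ≤ c * b) (x y : CoprodI G) :
    |T (x⁻¹ * y) - T y + T x| ≤ 1 := by
  have := (key hl (CoprodI.Word.equiv x) (CoprodI.Word.equiv y)).2
  have e : (CoprodI.Word.equiv x).prod = x := CoprodI.Word.equiv.symm_apply_apply x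
  rw [e] at this
  have e2 : x⁻¹ • CoprodI.Word.equiv y = CoprodI.Word.equiv (x⁻¹ * y) :=
    (mul_smul x⁻¹ y _).symm
  rwa [e2] at this

open scoped Classical in
theorem T_one [LinearOrder I] [∀ i, LinearOrder (G i)] : T (1 : CoprodI G) = 0 := by
  have : CoprodI.Word.equiv (1 : CoprodI G) = CoprodI.Word.empty :=
    one_smul (CoprodI G) (CoprodI.Word.empty : CoprodI.Word G)
  rw [T, this, tau_empty]

open scoped Classical in
theorem T_odd [LinearOrder I] [∀ i, LinearOrder (G i)] (x : CoprodI G) (hx : x ≠ 1) :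
    Odd (T x) := by
  apply tau_odd
  intro h
  apply hx
  have : CoprodI.Word.equiv (1 : CoprodI G) = CoprodI.Word.empty :=
    one_smul (CoprodI G) (CoprodI.Word.empty : CoprodI.Word G)
  exact CoprodI.Word.equiv.injective (h.trans this.symm)

open scoped Classical in
theorem T_of [LinearOrder I] [∀ i, LinearOrder (G i)] {i : I} (g : G i) (hg : g ≠ 1) :
    T (CoprodI.of g : CoprodI G) = sg g := by
  have h1 : (CoprodI.Word.empty : CoprodI.Word G).fstIdx ≠ some i := by
    simp [CoprodI.Word.fstIdx, CoprodI.Word.empty]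
  have : CoprodI.Word.equiv (CoprodI.of g : CoprodI G)
    = CoprodI.Word.cons g CoprodI.Word.empty h1 hg := CoprodI.Word.cons_eq_smul.symm
  rw [T, this, tau_cons, tau_empty]
  change sg g + 0 + 0 = _
  simp

theorem T_inv [LinearOrder I] [∀ i, LinearOrder (G i)]
    (hl : ∀ i, ∀ a b c : G i, a ≤ b → c * a ≤ c * b) (x : CoprodI G) :
    T x⁻¹ = - T x := by
  by_cases hx : x = 1
  · subst hx; simp [T_one]
  · have h := T_mul hl x 1
    rw [mul_one, T_one, abs_le] at h
    obtain ⟨a, ha⟩ := T_odd x hx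
    obtain ⟨b, hb⟩ := T_odd x⁻¹ (by simpa using hx)
    omega

open scoped Classical in
theorem exists_order [LinearOrder I] [∀ i, LinearOrder (G i)]
    (hl : ∀ i, ∀ a b c : G i, a ≤ b → c * a ≤ c * b) :
    ∃ ord' : LinearOrder (CoprodI G),
      (∀ a b c : CoprodI G, ord'.le a b → ord'.le (c * a) (c * b)) ∧
      (∀ i, ∀ g h : G i,
        g ≤ h ↔ ord'.le (CoprodI.of g) (CoprodI.of h)) := by
  have hsymm : ∀ a b : CoprodI G, T (b⁻¹ * a) = - T (a⁻¹ * b) := by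
    intro a b
    rw [← T_inv hl, mul_inv_rev, inv_inv]
  have hzero : ∀ a b : CoprodI G, T (a⁻¹ * b) = 0 → a = b := by
    intro a b h
    by_contra hab
    obtain ⟨k, hk⟩ := T_odd (a⁻¹ * b) (by rwa [ne_eq, inv_mul_eq_one])
    omega
  let o : LinearOrder (CoprodI G) :=
    { le := fun a b => 0 ≤ T (a⁻¹ * b)
      le_refl := fun a => by simp [T_one]
      le_trans := by
        intro a b c hab hbc
        by_cases h1 : a = b
        · rwa [h1]
        by_cases h2 : b = c
        · rwa [← h2]
        have h3 := T_mul hl (b⁻¹ * a) (b⁻¹ * c)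
        have e : (b⁻¹ * a)⁻¹ * (b⁻¹ * c) = a⁻¹ * c := by group
        rw [e, hsymm a b, abs_le] at h3
        have h4 := mt (hzero a b) h1
        have h5 := mt (hzero b c) h2
        omega
      le_antisymm := by
        intro a b hab hba
        rw [hsymm a b] at hba
        exact hzero a b (by omega)
      le_total := by
        intro a b
        rw [hsymm a b]
        omega
      toDecidableLE := Classical.decRel _ }
  refine ⟨o, ?_, ?_⟩
  · intro a b c h
    change 0 ≤ T ((c * a)⁻¹ * (c * b))
    have e : (c * a)⁻¹ * (c * b) = a⁻¹ * b := by group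
    rw [e]; exact h
  · intro i g h
    change _ ↔ 0 ≤ T ((CoprodI.of g)⁻¹ * CoprodI.of h : CoprodI G)
    rw [← map_inv, ← map_mul]
    by_cases hgh : g = h
    · subst hgh; simp [T_one]
    · rw [T_of _ (by rwa [ne_eq, inv_mul_eq_one]), sg_div (hl i)]
      grind

end

end FreeProdOrder

/-- Let `G_α`, `α ∈ I`, be nontrivial left ordered groups. Then there exists a
left-invariant linear order on their free product `𝓕 = *_{α∈I} G_α` which extends
the left orders of the factors (via the canonical inclusions `CoprodI.of`). -/
theorem exists_leftInvariant_linearOrder_coprodI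
    {I : Type*} {G : I → Type*} [∀ i, Group (G i)] [∀ i, Nontrivial (G i)]
    (ord : ∀ i, LinearOrder (G i))
    (hleft : ∀ i, ∀ a b c : G i, (ord i).le a b → (ord i).le (c * a) (c * b)) :
    ∃ ord' : LinearOrder (CoprodI G),
      (∀ a b c : CoprodI G, ord'.le a b → ord'.le (c * a) (c * b)) ∧
      (∀ i, ∀ g h : G i,
        (ord i).le g h ↔ ord'.le (CoprodI.of g) (CoprodI.of h)) := by
  classical
  let _ : LinearOrder I := linearOrderOfSTO (WellOrderingRel (α := I))
  exact FreeProdOrder.exists_order hleft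
end

section
/- Let H₁ and H₂ be finitely generated subgroups of a free group F. Then r̄(H₁ ∩ H₂) ≤ r̄(H₁) · r̄(H₂) (the Hanna Neumann conjecture). -/
universe u
namespace HN


section order
variable {X : Type u} [DecidableEq X]

/-- left multiplication by `1 + x` on power series -/
def up (x : X) (f : List X → ℤ) : List X → ℤ
  | [] => f []
  | y :: w => f (y :: w) + if y = x then f w else 0

/-- left multiplication by `(1 + x)⁻¹` -/
def dn (x : X) (f : List X → ℤ) : List X → ℤ
  | [] => f []
  | y :: w => f (y :: w) - if y = x then dn x f w else 0

lemma up_dn (x : X) (f : List X → ℤ) : up x (dn x f) = f := by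
  funext w
  cases w with
  | nil => rfl
  | cons y w => simp [up, dn]

lemma dn_up (x : X) (f : List X → ℤ) : dn x (up x f) = f := by
  funext w
  induction w with
  | nil => rfl
  | cons y w ih => simp [up, dn, ih]

def upPerm (x : X) : Equiv.Perm (List X → ℤ) where
  toFun := up x
  invFun := dn x
  left_inv := dn_up x
  right_inv := up_dn x

def magnus : FreeGroup X →* Equiv.Perm (List X → ℤ) := FreeGroup.lift upPerm

def delta : List X → ℤ := fun w => if w = [] then 1 else 0

lemma magnus_cons (x : X) (b : Bool) (L : List (X × Bool)) (f : List X → ℤ) :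
    magnus (FreeGroup.mk ((x, b) :: L)) f =
      if b then up x (magnus (FreeGroup.mk L) f) else dn x (magnus (FreeGroup.mk L) f) := by
  have : FreeGroup.mk ((x, b) :: L) = FreeGroup.mk [(x, b)] * FreeGroup.mk L := by
    simp [FreeGroup.mul_mk]
  rw [this, map_mul, Equiv.Perm.mul_apply]
  cases b with
  | true =>
    have : FreeGroup.mk [(x, true)] = FreeGroup.of x := rfl
    rw [this]; simp [magnus, upPerm]
  | false =>
    have : FreeGroup.mk [(x, false)] = (FreeGroup.of x)⁻¹ := rfl
    rw [this]; simp [magnus]; rfl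

lemma dn_of_ne (x : X) (f : List X → ℤ) (t : List X) (h : t.head? ≠ some x) :
    dn x f t = f t := by
  cases t with
  | nil => rfl
  | cons y w => simp at h; simp [dn, h]

lemma up_of_ne (x : X) (f : List X → ℤ) (t : List X) (h : t.head? ≠ some x) :
    up x f t = f t := by
  cases t with
  | nil => rfl
  | cons y w => simp at h; simp [up, h]

lemma magnus_key (L : List (X × Bool)) (hL : FreeGroup.IsReduced L) :
    L = [] ∨ ∃ x b L' t, ∃ m : ℤ, L = (x, b) :: L' ∧ List.IsChain (· ≠ ·) (x :: t) ∧
      (if b then 0 < m else m < 0) ∧ magnus (FreeGroup.mk L) delta t ≠ 0 ∧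
      magnus (FreeGroup.mk L) delta (x :: t) = m * magnus (FreeGroup.mk L) delta t ∧
      (∀ w : List X, List.IsChain (· ≠ ·) w → t.length + 1 < w.length →
        magnus (FreeGroup.mk L) delta w = 0) ∧
      ∀ w : List X, List.IsChain (· ≠ ·) w → w.head? ≠ some x → t.length < w.length →
        magnus (FreeGroup.mk L) delta w = 0 := by
  induction L with
  | nil => left; rfl
  | cons a L ih =>
    right
    obtain ⟨y, c⟩ := a
    have hL' : FreeGroup.IsReduced L := by
      exact List.IsChain.tail hL
    have hdn : ∀ (g : List X → ℤ) (w : List X), List.IsChain (· ≠ ·) (y :: w) →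
        (if c then up y g else dn y g) (y :: w) = g (y :: w) + (if c then 1 else -1) * g w := by
      intro g w hw
      have : w.head? ≠ some y := by
        cases w with
        | nil => simp
        | cons z w => simp at hw; simp; tauto
      cases c
      · simp [dn, dn_of_ne _ _ _ this]; ring
      · simp [up]
    have hne : ∀ (g : List X → ℤ) (w : List X), w.head? ≠ some y →
        (if c then up y g else dn y g) w = g w := by
      intro g w hw
      cases c
      · simp [dn_of_ne _ _ _ hw]
      · simp [up_of_ne _ _ _ hw]
    rcases ih hL' with rfl | ⟨x, b, L', t, m, rfl, hch, hm, h0, h1, h2, h3⟩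
    · have h1 : (magnus (FreeGroup.mk []) delta : List X → ℤ) = delta := by
        rw [← FreeGroup.one_eq_mk]; simp
      refine ⟨y, c, [], [], if c then 1 else -1, rfl, by simp, by cases c <;> simp, ?_, ?_, ?_, ?_⟩
      · rw [magnus_cons, hne _ _ (by simp), h1]; simp [delta]
      · rw [magnus_cons, hne _ [] (by simp), hdn _ [] (by simp), h1]; simp [delta]
      · intro w hw hl
        rw [magnus_cons, h1]
        obtain _ | ⟨z, w⟩ := w
        · simp at hl
        by_cases hz : z = y
        · subst hz
          have : w ≠ [] := by rintro rfl; simp at hl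
          rw [hdn _ _ hw]; simp [delta, this]
        · rw [hne _ _ (by simpa using hz)]; simp [delta]
      · intro w hw hh hl
        rw [magnus_cons, h1, hne _ _ hh]
        have : w ≠ [] := by rintro rfl; simp at hl
        simp [delta, this]
    · have hbound : ∀ w : List X, List.IsChain (· ≠ ·) w → t.length + 2 < w.length →
          magnus (FreeGroup.mk ((y, c) :: (x, b) :: L')) delta w = 0 := by
        intro w hw hl
        rw [magnus_cons]
        obtain _ | ⟨z, w⟩ := w
        · simp at hl
        by_cases hz : z = y
        · subst hz
          simp at hl
          rw [hdn _ _ hw, h2 _ hw (by simp; omega), h2 w hw.tail (by omega)]; simp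
        · rw [hne _ _ (by simpa using hz), h2 _ hw (by omega)]
      by_cases hxy : y = x
      · subst hxy
        have hcb : c = b := by
          have := hL
          simp [FreeGroup.IsReduced] at this
          exact this.1
        subst hcb
        have ht : t.head? ≠ some y := by
          cases t with
          | nil => simp
          | cons z w => simp at hch; simp; tauto
        refine ⟨y, c, _, t, m + if c then 1 else -1, rfl, hch, ?_, ?_, ?_, ?_, ?_⟩
        · cases c <;> simp at hm ⊢ <;> omega
        · rwa [magnus_cons, hne _ _ ht]
        · rw [magnus_cons, hne _ _ ht, hdn _ _ hch, h1]; ring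
        · intro w hw hl
          rw [magnus_cons]
          obtain _ | ⟨z, w⟩ := w
          · simp at hl
          by_cases hz : z = y
          · subst hz
            simp at hl
            rw [hdn _ _ hw, h2 _ hw (by simp; omega)]
            rw [h3 w hw.tail ?_ (by omega)]
            · simp
            · cases w with
              | nil => simp
              | cons z w => simp at hw; simp; tauto
          · rw [hne _ _ (by simpa using hz), h2 _ hw (by omega)]
        · intro w hw hh hl
          rw [magnus_cons, hne _ _ hh, h3 w hw hh hl]
      · have hch' : List.IsChain (· ≠ ·) (y :: x :: t) := by
          rw [List.isChain_cons_cons]; exact ⟨hxy, hch⟩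
        refine ⟨y, c, _, x :: t, if c then 1 else -1, rfl, hch', by cases c <;> simp, ?_, ?_, ?_, ?_⟩
        · rw [magnus_cons, hne _ _ (by simpa using Ne.symm hxy), h1]
          refine mul_ne_zero ?_ h0
          rintro rfl
          simp at hm
        · rw [magnus_cons, hne _ (x :: t) (by simpa using Ne.symm hxy), hdn _ _ hch',
            h2 _ hch' (by simp)]; simp
        · exact hbound
        · intro w hw hh hl
          rw [magnus_cons, hne _ _ hh, h2 w hw (by simpa using hl)]

lemma magnus_inj (g : FreeGroup X) (hg : magnus g delta = delta) : g = 1 := by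
  rcases magnus_key g.toWord FreeGroup.isReduced_toWord with h | ⟨x, b, L', t, m, h, -, hm, h0, h1, -⟩
  · exact FreeGroup.toWord_eq_nil_iff.mp h
  · rw [FreeGroup.mk_toWord, hg] at h0 h1
    exfalso
    have : m ≠ 0 := by rintro rfl; simp at hm
    rw [eq_comm] at h1
    simp [delta] at h1 h0
    tauto

open Classical in
lemma exists_listOrder (X : Type u) : ∃ lo : LinearOrder (List X),
    @WellFoundedLT (List X) lo.toLT ∧ ∀ (x : X) (w : List X), lo.lt w (x :: w) := by
  obtain ⟨l0, hl0⟩ := exists_wellFoundedLT (List X)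
  let φ : List X → ℕ ×ₗ List X := fun w => toLex (w.length, w)
  have hφ : Function.Injective φ := by
    intro a b h
    have := congrArg (fun p => (ofLex p).2) h
    exact this
  have h1 : WellFounded (fun a b => φ a < φ b) := InvImage.wf φ (wellFounded_lt)
  have h2 : ∀ (x : X) (w : List X), φ w < φ (x :: w) := by
    intro x w
    rw [Prod.Lex.lt_iff]
    left; simp [φ]
  exact ⟨LinearOrder.lift' φ hφ, ⟨h1⟩, h2⟩

end order

section order2
variable {X : Type u}

open Classical in
theorem exists_leftOrder : ∃ lo : LinearOrder (FreeGroup X), ∀ a b c : FreeGroup X,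
    lo.lt a b → lo.lt (c * a) (c * b) := by
  obtain ⟨l1, hl1, hl⟩ := exists_listOrder X
  let Φ : FreeGroup X → Lex (List X → ℤ) := fun g => toLex (magnus g delta)
  have hΦ : Function.Injective Φ := by
    intro a b h
    have h' : magnus a delta = magnus b delta := h
    have : magnus (b⁻¹ * a) delta = delta := by
      rw [map_mul, Equiv.Perm.mul_apply, h', ← Equiv.Perm.mul_apply, ← map_mul]; simp
    have := magnus_inj _ this
    rw [inv_mul_eq_one] at this
    exact this.symm
  refine ⟨LinearOrder.lift' Φ hΦ, ?_⟩
  have hup : ∀ (x : X) (f g : List X → ℤ), toLex f < toLex g → toLex (up x f) < toLex (up x g) := by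
    rintro x f g ⟨i, h1, h2⟩
    refine ⟨i, ?_, ?_⟩
    · intro j hj
      cases j with
      | nil => exact h1 _ hj
      | cons y w =>
        have a := h1 _ hj
        have b := h1 w ((hl y w).trans hj)
        simp at a b
        simp [up, a, b]
    · cases i with
      | nil => exact h2
      | cons y w =>
        have b := h1 w (hl y w)
        simp at b h2
        simpa [up, b] using h2
  have hdn : ∀ (x : X) (f g : List X → ℤ), toLex f < toLex g → toLex (dn x f) < toLex (dn x g) := by
    intro x f g h
    rcases lt_trichotomy (toLex (dn x f)) (toLex (dn x g)) with h1 | h1 | h1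
    · exact h1
    · have h2 : dn x f = dn x g := h1
      have := congrArg (up x) h2
      rw [up_dn, up_dn] at this
      subst this
      exact absurd h (lt_irrefl _)
    · have := hup x _ _ h1
      rw [up_dn, up_dn] at this
      exact absurd h this.not_gt
  intro a b c
  change toLex (magnus a delta) < toLex (magnus b delta) →
    toLex (magnus (c * a) delta) < toLex (magnus (c * b) delta)
  induction c using FreeGroup.induction_on generalizing a b with
  | C1 => simp
  | of x =>
    intro h
    rw [map_mul, map_mul, Equiv.Perm.mul_apply, Equiv.Perm.mul_apply]
    simpa [magnus, upPerm] using hup x _ _ h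
  | inv_of x _ =>
    intro h
    rw [map_mul, map_mul, Equiv.Perm.mul_apply, Equiv.Perm.mul_apply, map_inv]
    have := hdn x _ _ h
    have e : ∀ f, (magnus (FreeGroup.of x))⁻¹ f = dn x f := by
      intro f; simp [magnus]; rfl
    simpa [e] using this
  | mul y z hy hz =>
    intro h
    rw [mul_assoc, mul_assoc]
    exact hy _ _ (hz _ _ h)

end order2
end HN

namespace HN


section graph
variable {X : Type u}

/-- edges of the Cayley graph of a free group -/
@[ext]
structure HEdge (X : Type u) where
  s : FreeGroup X
  x : X

def HEdge.t (e : HEdge X) : FreeGroup X := e.s * FreeGroup.of e.x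

def sm (g : FreeGroup X) (e : HEdge X) : HEdge X := ⟨g * e.s, e.x⟩

lemma sm_s (g : FreeGroup X) (e : HEdge X) : (sm g e).s = g * e.s := rfl
lemma sm_t (g : FreeGroup X) (e : HEdge X) : (sm g e).t = g * e.t := by
  simp [sm, HEdge.t, mul_assoc]
lemma sm_inv_sm (g : FreeGroup X) (e : HEdge X) : sm g⁻¹ (sm g e) = e := by
  simp [sm]
lemma sm_sm_inv (g : FreeGroup X) (e : HEdge X) : sm g (sm g⁻¹ e) = e := by
  simp [sm]

def Conn (S : Set (HEdge X)) : FreeGroup X → FreeGroup X → Prop :=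
  Relation.EqvGen (fun u v => ∃ e ∈ S, e.s = u ∧ e.t = v)

lemma Conn.refl (S : Set (HEdge X)) (u) : Conn S u u := Relation.EqvGen.refl _
lemma Conn.symm {S : Set (HEdge X)} {u v} (h : Conn S u v) : Conn S v u := Relation.EqvGen.symm _ _ h
lemma Conn.trans {S : Set (HEdge X)} {u v w} (h : Conn S u v) (h' : Conn S v w) : Conn S u w :=
  Relation.EqvGen.trans _ _ _ h h'
lemma Conn.edge {S : Set (HEdge X)} {e} (h : e ∈ S) : Conn S e.s e.t :=
  Relation.EqvGen.rel _ _ ⟨e, h, rfl, rfl⟩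

/-- Induction: a property constant along edges is constant on components. -/
lemma Conn.inv {S : Set (HEdge X)} {u v} (h : Conn S u v) {α : Sort*} (f : FreeGroup X → α)
    (hf : ∀ e ∈ S, f e.s = f e.t) : f u = f v := by
  induction h with
  | rel x y h => obtain ⟨e, he, rfl, rfl⟩ := h; exact hf e he
  | refl x => rfl
  | symm x y _ ih => exact ih.symm
  | trans x y z _ _ h1 h2 => exact h1.trans h2

lemma Conn.mono {S T : Set (HEdge X)} (hST : S ⊆ T) {u v} (h : Conn S u v) : Conn T u v := by
  induction h with
  | rel x y h => obtain ⟨e, he, rfl, rfl⟩ := h; exact Conn.edge (hST he)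
  | refl x => exact Conn.refl _ _
  | symm x y _ ih => exact ih.symm
  | trans x y z _ _ h1 h2 => exact h1.trans h2

lemma Conn.smul {S T : Set (HEdge X)} (g : FreeGroup X) (hST : ∀ e ∈ S, sm g e ∈ T)
    {u v} (h : Conn S u v) : Conn T (g * u) (g * v) := by
  induction h with
  | rel x y h =>
    obtain ⟨e, he, rfl, rfl⟩ := h
    have := Conn.edge (hST e he)
    rwa [sm_s, sm_t] at this
  | refl x => exact Conn.refl _ _
  | symm x y _ ih => exact ih.symm
  | trans x y z _ _ h1 h2 => exact h1.trans h2

/-- potentials -/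
lemma exists_potential {k : Type*} [AddCommGroup k] (c : HEdge X → k) (a : k) :
    ∃ f : FreeGroup X → k, f 1 = a ∧ ∀ e : HEdge X, f e.t = f e.s + c e := by
  let σ : X → (Equiv.Perm (FreeGroup X × k))ᵐᵒᵖ := fun x => MulOpposite.op
    { toFun := fun p => (p.1 * FreeGroup.of x, p.2 + c ⟨p.1, x⟩)
      invFun := fun p => (p.1 * (FreeGroup.of x)⁻¹, p.2 - c ⟨p.1 * (FreeGroup.of x)⁻¹, x⟩)
      left_inv := by intro p; simp
      right_inv := by intro p; simp }
  let L : FreeGroup X →* _ := FreeGroup.lift σ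
  have hL : ∀ g u, ((L g).unop u).1 = u.1 * g := by
    intro g
    induction g using FreeGroup.induction_on with
    | C1 => simp
    | of x => intro u; simp [L, σ]
    | inv_of x _ => intro u; simp [L, σ]
    | mul y z hy hz => intro u; simp [hy, hz, mul_assoc]
  refine ⟨fun g => ((L g).unop (1, a)).2, by simp, ?_⟩
  intro e
  have h1 := hL e.s (1, a)
  simp only [HEdge.t, map_mul, MulOpposite.unop_mul, Equiv.Perm.mul_apply]
  have : (L (FreeGroup.of e.x)).unop = (σ e.x).unop := by simp [L]
  rw [this]
  simp only [σ, MulOpposite.unop_op, Equiv.coe_fn_mk]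
  rw [h1]
  simp

lemma conn_univ (u v : FreeGroup X) : Conn Set.univ u v := by
  suffices ∀ g u : FreeGroup X, Conn Set.univ u (u * g) by
    have := this (u⁻¹ * v) u
    simpa using this
  intro g
  induction g using FreeGroup.induction_on with
  | C1 => intro u; simpa using Conn.refl _ _
  | of x => intro u; exact Conn.edge (e := ⟨u, x⟩) (Set.mem_univ _)
  | inv_of x _ =>
    intro u
    have := (Conn.edge (e := ⟨u * (FreeGroup.of x)⁻¹, x⟩) (Set.mem_univ _)).symm
    simpa [HEdge.t] using this
  | mul y z hy hz =>
    intro u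
    have := (hy u).trans (hz (u * y))
    rwa [mul_assoc] at this

lemma bridge {S : Set (HEdge X)} {e : HEdge X} (he : e ∉ S) : ¬ Conn S e.s e.t := by
  classical
  intro h
  obtain ⟨f, -, hf⟩ := exists_potential (fun e' => if e' = e then (1 : ℤ) else 0) 0
  have := h.inv f (by
    intro e' he'
    have : e' ≠ e := by rintro rfl; exact he he'
    rw [hf]; simp [this])
  rw [hf] at this
  simp at this

/-- induced edges -/
def edg (V : Set (FreeGroup X)) : Set (HEdge X) := {e | e.s ∈ V ∧ e.t ∈ V}

def q (H : Subgroup (FreeGroup X)) (g : FreeGroup X) : Quotient (QuotientGroup.rightRel H) :=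
  Quotient.mk _ g

def qe (H : Subgroup (FreeGroup X)) (e : HEdge X) : Quotient (QuotientGroup.rightRel H) × X :=
  (q H e.s, e.x)

lemma q_eq {H : Subgroup (FreeGroup X)} {g g' : FreeGroup X} :
    q H g = q H g' ↔ ∃ h ∈ H, g' = h * g := by
  unfold q
  rw [Quotient.eq, QuotientGroup.rightRel_apply]
  constructor
  · intro h; exact ⟨_, h, by simp⟩
  · rintro ⟨h, hh, rfl⟩; simpa using hh

lemma qe_eq {H : Subgroup (FreeGroup X)} {e e' : HEdge X} :
    qe H e = qe H e' ↔ ∃ h ∈ H, e' = sm h e := by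
  unfold qe
  rw [Prod.mk.injEq, q_eq]
  constructor
  · rintro ⟨⟨h, hh, h1⟩, h2⟩
    exact ⟨h, hh, by ext1; exact h1; exact h2.symm⟩
  · rintro ⟨h, hh, rfl⟩
    exact ⟨⟨h, hh, rfl⟩, rfl⟩

structure Tree (H : Subgroup (FreeGroup X)) (V : Set (FreeGroup X)) : Prop where
  one : 1 ∈ V
  inv : ∀ h ∈ H, ∀ v ∈ V, h * v ∈ V
  conn : ∀ u ∈ V, ∀ v ∈ V, Conn (edg V) u v
  finV : (q H '' V).Finite
  finE : (qe H '' edg V).Finite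

lemma Tree.invE {H : Subgroup (FreeGroup X)} {V : Set (FreeGroup X)} (T : Tree H V)
    {h} (hh : h ∈ H) {e} (he : e ∈ edg V) : sm h e ∈ edg V := by
  refine ⟨T.inv h hh _ he.1, ?_⟩
  rw [sm_t]; exact T.inv h hh _ he.2

lemma Tree.qe_mem {H : Subgroup (FreeGroup X)} {V : Set (FreeGroup X)} (T : Tree H V)
    {e} (he : qe H e ∈ qe H '' edg V) : e ∈ edg V := by
  obtain ⟨e', he', h⟩ := he
  obtain ⟨h, hh, rfl⟩ := qe_eq.mp h
  exact T.invE hh he'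

/-- Euler characteristic. -/
theorem euler {H : Subgroup (FreeGroup X)} {V : Set (FreeGroup X)} (T : Tree H V)
    {B : Type*} (φ : FreeGroup B ≃* H) :
    Finite B ∧ Nat.card B + (q H '' V).ncard = (qe H '' edg V).ncard + 1 := by
  classical
  let k := ZMod 2
  let W := {p : (V → k) × (H →* Multiplicative k) //
    ∀ (h : H) (v : V), p.1 ⟨h * v, T.inv h h.2 v v.2⟩ = (p.2 h).toAdd + p.1 v}
  let A := (q H '' V)
  let C := (qe H '' edg V)
  have : Finite A := T.finV
  have : Finite C := T.finE
  choose rep hrep1 hrep2 using fun a : A => a.2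
  let Ψ : W → (A → k) × (H →* Multiplicative k) := fun p => (fun a => p.1.1 ⟨rep a, hrep1 a⟩, p.1.2)
  have hV : ∀ v : V, ∃ h : H, ∃ a : A, (v : FreeGroup X) = h * rep a ∧ a = q H v := by
    intro v
    have hm : q H v ∈ A := ⟨v, v.2, rfl⟩
    obtain ⟨h, hh, h1⟩ := q_eq.mp (hrep2 ⟨_, hm⟩)
    exact ⟨⟨h, hh⟩, ⟨_, hm⟩, h1, rfl⟩
  choose hv av hva hvq using hV
  have hΨ : Function.Bijective Ψ := by
    constructor
    · rintro ⟨⟨f, φ1⟩, h1⟩ ⟨⟨g, φ2⟩, h2⟩ h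
      simp only [Ψ, Prod.mk.injEq] at h
      obtain ⟨h, rfl⟩ := h
      simp only at h1 h2
      have : f = g := by
        funext v
        have e : v = ⟨hv v * rep (av v), T.inv _ (hv v).2 _ (hrep1 _)⟩ := Subtype.ext (hva v)
        rw [e, h1 (hv v) ⟨rep (av v), hrep1 _⟩, h2 (hv v) ⟨rep (av v), hrep1 _⟩]
        rw [congrFun h (av v)]
      subst this
      rfl
    · rintro ⟨a, φ1⟩
      refine ⟨⟨(fun v => (φ1 (hv v)).toAdd + a (av v), φ1), ?_⟩, ?_⟩
      · intro h v
        set v' : V := ⟨h * v, T.inv h h.2 v v.2⟩ with hv'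
        have e1 : av v' = av v := by
          apply Subtype.ext
          rw [hvq, hvq]
          exact ((q_eq (H := H)).mpr ⟨(h : FreeGroup X), h.2, rfl⟩).symm
        have e2 : hv v' = h * hv v := by
          have := hva v'
          rw [e1] at this
          have h3 : (v' : FreeGroup X) = h * v := rfl
          rw [h3, hva v, ← mul_assoc] at this
          exact Subtype.ext (mul_right_cancel this).symm
        simp only [e1, e2, map_mul, toAdd_mul]
        abel
      · simp only [Ψ, Prod.mk.injEq, and_true]
        funext b
        have e1 : av ⟨rep b, hrep1 b⟩ = b := by
          apply Subtype.ext
          rw [hvq]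
          exact hrep2 b
        have e2 : hv ⟨rep b, hrep1 b⟩ = 1 := by
          have := hva ⟨rep b, hrep1 b⟩
          rw [e1] at this
          apply Subtype.ext
          simpa using this
        rw [e1, e2]; simp
  let Θ : W → k × (C → k) := fun p => (p.1.1 ⟨1, T.one⟩, fun c =>
    p.1.1 ⟨_, c.2.choose_spec.1.2⟩ - p.1.1 ⟨_, c.2.choose_spec.1.1⟩)
  have hrepE : ∀ (p : W) (e : HEdge X) (he : e ∈ edg V),
      p.1.1 ⟨_, he.2⟩ - p.1.1 ⟨_, he.1⟩ = (Θ p).2 ⟨qe H e, e, he, rfl⟩ := by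
    intro p e he
    have hm : qe H e ∈ qe H '' edg V := ⟨e, he, rfl⟩
    change _ = p.1.1 ⟨hm.choose.t, hm.choose_spec.1.2⟩ - p.1.1 ⟨hm.choose.s, hm.choose_spec.1.1⟩
    obtain ⟨h, hh, h1⟩ := qe_eq.mp hm.choose_spec.2
    set e' := hm.choose
    have he' := hm.choose_spec.1
    have a1 := p.2 ⟨h, hh⟩ ⟨e'.t, he'.2⟩
    have a2 := p.2 ⟨h, hh⟩ ⟨e'.s, he'.1⟩
    have b1 : (⟨e.t, he.2⟩ : V) = ⟨h * e'.t, T.inv _ hh _ he'.2⟩ := by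
      apply Subtype.ext; simp only; rw [h1, sm_t]
    have b2 : (⟨e.s, he.1⟩ : V) = ⟨h * e'.s, T.inv _ hh _ he'.1⟩ := by
      apply Subtype.ext; simp only; rw [h1, sm_s]
    rw [b1, b2]
    simp only at a1 a2
    rw [a1, a2]; abel
  have hΘ : Function.Bijective Θ := by
    constructor
    · intro p p' h
      have key : p.1.1 = p'.1.1 := by
        funext v
        let f : FreeGroup X → k := fun g => if hg : g ∈ V then p.1.1 ⟨g, hg⟩ - p'.1.1 ⟨g, hg⟩ else 0
        have := (T.conn 1 T.one v v.2).inv f (by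
          intro e he
          have a1 := hrepE p e he
          have a2 := hrepE p' e he
          rw [h] at a1
          have he1 : e.s ∈ V := he.1
          have he2 : e.t ∈ V := he.2
          simp only [f, he1, he2, dif_pos]
          rw [← a2] at a1
          rw [sub_eq_sub_iff_add_eq_add] at a1 ⊢
          rw [add_comm, ← a1, add_comm])
        simp only [f, T.one, v.2, dif_pos] at this
        have h0 : p.1.1 ⟨1, T.one⟩ = p'.1.1 ⟨1, T.one⟩ := congrArg Prod.fst h
        rw [h0, sub_self] at this
        exact sub_eq_zero.mp this.symm
      apply Subtype.ext
      refine Prod.ext key ?_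
      ext h
      have a1 := p.2 h ⟨1, T.one⟩
      have a2 := p'.2 h ⟨1, T.one⟩
      rw [key] at a1
      rw [a1] at a2
      exact add_right_cancel a2
    · rintro ⟨a, c⟩
      obtain ⟨f, hf1, hf⟩ := exists_potential
        (fun e => if he : qe H e ∈ C then c ⟨_, he⟩ else 0) a
      have hconst : ∀ h : H, ∀ g : FreeGroup X, f (h * g) = (f h - f 1) + f g := by
        intro h g
        have := (conn_univ 1 g).inv (fun g => f (h * g) - f g) (by
          intro e _
          have a1 := hf (sm h e)
          rw [sm_t, sm_s] at a1
          have hq : qe H (sm h e) = qe H e := ((qe_eq (H := H)).mpr ⟨(h : FreeGroup X), h.2, rfl⟩).symm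
          rw [a1, hf e]
          simp only [hq]; abel)
        simp only [mul_one] at this
        rw [this]; abel
      let φ1 : H →* Multiplicative k :=
        { toFun := fun h => Multiplicative.ofAdd (f h - f 1)
          map_one' := by simp
          map_mul' := by
            intro x y
            rw [← ofAdd_add]
            congr 1
            rw [Subgroup.coe_mul, hconst]; abel }
      refine ⟨⟨(fun v => f v, φ1), ?_⟩, ?_⟩
      · intro h v
        exact hconst h v
      · refine Prod.ext hf1 ?_
        funext ⟨c', hc'⟩
        obtain ⟨e, he, rfl⟩ := hc'
        rw [← hrepE]
        · simp only [hf]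
          have : qe H e ∈ C := ⟨e, he, rfl⟩
          simp [this]
        · exact he
  let eq1 : k × (C → k) ≃ (A → k) × (B → k) :=
    (Equiv.ofBijective Θ hΘ).symm.trans ((Equiv.ofBijective Ψ hΨ).trans
      (Equiv.prodCongr (Equiv.refl _)
        ((MulEquiv.monoidHomCongrLeftEquiv (N := Multiplicative k) φ).symm.trans FreeGroup.lift.symm)))
  have hfin : Finite ((A → k) × (B → k)) := Finite.of_equiv _ eq1
  have hB : Finite (B → k) := Finite.of_surjective (Prod.snd : (A → k) × (B → k) → (B → k)) Prod.snd_surjective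
  have hB' : Finite B := by
    by_contra hn
    rw [not_finite_iff_infinite] at hn
    exact not_finite (B → k)
  refine ⟨hB', ?_⟩
  have hc := Nat.card_congr eq1
  rw [Nat.card_prod, Nat.card_prod, Nat.card_fun, Nat.card_fun, Nat.card_fun] at hc
  have h2 : Nat.card k = 2 := by simp [k]
  rw [h2, ← pow_succ', ← pow_add] at hc
  have := Nat.pow_right_injective (le_refl 2) hc
  change _ + Nat.card A = Nat.card C + 1
  omega

end graph
end HN

namespace HN


section kruskal
variable {X : Type u}

set_option linter.unusedSectionVars false

def comp (S : Set (HEdge X)) (v : FreeGroup X) : Set (FreeGroup X) := {w | Conn S v w}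

lemma comp_mono {S T : Set (HEdge X)} (h : S ⊆ T) (v : FreeGroup X) : comp S v ⊆ comp T v :=
  fun _ hw => Conn.mono h hw

lemma comp_eq {S : Set (HEdge X)} {u v : FreeGroup X} (h : Conn S u v) : comp S u = comp S v := by
  ext w; exact ⟨fun hw => h.symm.trans hw, fun hw => h.trans hw⟩

lemma comp_smul {S T : Set (HEdge X)} (g : FreeGroup X)
    (h : ∀ e, e ∈ S ↔ sm g e ∈ T) (v : FreeGroup X) :
    comp T (g * v) = (fun w => g * w) '' comp S v := by
  ext w
  constructor
  · intro hw
    have : Conn S (g⁻¹ * (g * v)) (g⁻¹ * w) := Conn.smul g⁻¹ (by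
      intro e he
      rw [h, sm_sm_inv]; exact he) hw
    rw [inv_mul_cancel_left] at this
    exact ⟨_, this, by simp⟩
  · rintro ⟨w, hw, rfl⟩
    exact Conn.smul g (fun e he => (h e).mp he) hw

def Ends (e : HEdge X) (a b : FreeGroup X) : Prop := (a = e.s ∧ b = e.t) ∨ (a = e.t ∧ b = e.s)

lemma Ends.conn {S : Set (HEdge X)} {e : HEdge X} {a b} (h : Ends e a b) (he : e ∈ S) : Conn S a b := by
  rcases h with ⟨rfl, rfl⟩ | ⟨rfl, rfl⟩
  · exact Conn.edge he
  · exact (Conn.edge he).symm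

lemma Ends.symm {e : HEdge X} {a b} (h : Ends e a b) : Ends e b a := by
  unfold Ends at *; tauto

lemma Ends.mem {e : HEdge X} {a b} {V : Set (FreeGroup X)} (h : Ends e a b) (he : e ∈ edg V) : a ∈ V := by
  rcases h with ⟨rfl, rfl⟩ | ⟨rfl, rfl⟩
  exacts [he.1, he.2]

lemma Ends.smul {e : HEdge X} {a b} (g) (h : Ends e a b) : Ends (sm g e) (g * a) (g * b) := by
  unfold Ends; rw [sm_s, sm_t]
  rcases h with ⟨rfl, rfl⟩ | ⟨rfl, rfl⟩ <;> simp

lemma Ends.bridge {S : Set (HEdge X)} {e : HEdge X} {a b} (h : Ends e a b) (he : e ∉ S) : ¬ Conn S a b := by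
  rcases h with ⟨rfl, rfl⟩ | ⟨rfl, rfl⟩
  · exact HN.bridge he
  · exact fun h => HN.bridge he h.symm

lemma conn_mem {V : Set (FreeGroup X)} {S : Set (HEdge X)} (hS : S ⊆ edg V) {u v} (h : Conn S u v)
    (hu : u ∈ V) : v ∈ V := by
  have := h.inv (fun g => g ∈ V) (fun e he => by simp [(hS he).1, (hS he).2])
  rwa [← this]

variable [LinearOrder (FreeGroup X)] [LinearOrder (HEdge X)]

def lo (V : Set (FreeGroup X)) (e : HEdge X) : Set (HEdge X) := {e' | e' ∈ edg V ∧ e' < e}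
def loe (V : Set (FreeGroup X)) (e : HEdge X) : Set (HEdge X) := {e' | e' ∈ edg V ∧ e' ≤ e}

def Ess (V : Set (FreeGroup X)) : Set (HEdge X) :=
  {e | e ∈ edg V ∧ (comp (lo V e) e.s).Infinite ∧ (comp (lo V e) e.t).Infinite}

def Kills (V : Set (FreeGroup X)) (e : HEdge X) (v : FreeGroup X) : Prop :=
  ∃ a b, Ends e a b ∧ (comp (lo V e) a).Finite ∧ v ∈ comp (lo V e) a ∧
    (∀ w ∈ comp (lo V e) a, v ≤ w) ∧ ((comp (lo V e) b).Infinite ∨ ∃ w ∈ comp (lo V e) b, w < v)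

lemma lo_subset {V : Set (FreeGroup X)} {e : HEdge X} : lo V e ⊆ edg V := fun _ h => h.1
lemma lo_loe {V : Set (FreeGroup X)} {e : HEdge X} : lo V e ⊆ loe V e := fun _ h => ⟨h.1, h.2.le⟩
lemma loe_mono {V : Set (FreeGroup X)} {e e' : HEdge X} (h : e ≤ e') : loe V e ⊆ loe V e' :=
  fun _ hx => ⟨hx.1, hx.2.trans h⟩
lemma not_mem_lo {V : Set (FreeGroup X)} {e : HEdge X} : e ∉ lo V e := fun h => lt_irrefl _ h.2

lemma exists_kills {V : Set (FreeGroup X)} {e : HEdge X} (he : e ∈ edg V) (hn : e ∉ Ess V) :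
    ∃ v ∈ V, Kills V e v := by
  have main : ∀ a b, Ends e a b → (comp (lo V e) a).Finite → ∃ v ∈ V, Kills V e v := by
    intro a b hab hfa
    have hmin : ∀ c, (comp (lo V e) c).Finite →
        ∃ v ∈ comp (lo V e) c, ∀ w ∈ comp (lo V e) c, v ≤ w := by
      intro c hc
      obtain ⟨v, hv, h⟩ := Set.exists_min_image _ id hc ⟨c, Conn.refl _ _⟩
      exact ⟨v, hv, h⟩
    obtain ⟨v, hv, hvm⟩ := hmin a hfa
    have hvV := conn_mem lo_subset hv (hab.mem he)
    by_cases hfb : (comp (lo V e) b).Finite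
    · obtain ⟨v', hv', hvm'⟩ := hmin b hfb
      have hvV' := conn_mem lo_subset hv' (hab.symm.mem he)
      rcases lt_trichotomy v v' with h | h | h
      · exact ⟨v', hvV', b, a, hab.symm, hfb, hv', hvm', Or.inr ⟨v, hv, h⟩⟩
      · subst h
        exact absurd (Conn.trans hv (Conn.symm hv')) (hab.bridge not_mem_lo)
      · exact ⟨v, hvV, a, b, hab, hfa, hv, hvm, Or.inr ⟨v', hv', h⟩⟩
    · exact ⟨v, hvV, a, b, hab, hfa, hv, hvm, Or.inl hfb⟩
  by_cases h1 : (comp (lo V e) e.s).Finite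
  · exact main _ _ (Or.inl ⟨rfl, rfl⟩) h1
  by_cases h2 : (comp (lo V e) e.t).Finite
  · exact main _ _ (Or.inr ⟨rfl, rfl⟩) h2
  exact absurd ⟨he, h1, h2⟩ hn

lemma Kills.not_ess {V : Set (FreeGroup X)} {e : HEdge X} {v} (h : Kills V e v) : e ∉ Ess V := by
  rintro ⟨-, h1, h2⟩
  obtain ⟨a, b, hab, hf, -⟩ := h
  rcases hab with ⟨rfl, rfl⟩ | ⟨rfl, rfl⟩
  · exact h1 hf
  · exact h2 hf

lemma kills_inj {V : Set (FreeGroup X)} {e e' : HEdge X} (he : e ∈ edg V) (he' : e' ∈ edg V) {v}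
    (h : Kills V e v) (h' : Kills V e' v) : e = e' := by
  have main : ∀ e e', e ∈ edg V → Kills V e v → Kills V e' v → ¬ e < e' := by
    rintro e e' he ⟨a, b, hab, hf, hv, hm, hd⟩ ⟨a', b', hab', hf', hv', hm', hd'⟩ hlt
    have hsub : loe V e ⊆ lo V e' := fun x hx => ⟨hx.1, hx.2.trans_lt hlt⟩
    have hc : Conn (lo V e') a' b := by
      refine Conn.trans hv' ?_
      refine Conn.mono hsub ?_
      refine Conn.trans (Conn.mono lo_loe hv).symm ?_
      exact hab.conn ⟨he, le_rfl⟩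
    have hsub2 : comp (lo V e) b ⊆ comp (lo V e') a' := by
      rw [comp_eq hc]
      exact comp_mono (lo_loe.trans hsub) _
    rcases hd with hd | ⟨w, hw, hwv⟩
    · exact hd (hf'.subset hsub2)
    · exact absurd (hm' w (hsub2 hw)) hwv.not_ge
  rcases lt_trichotomy e e' with hl | hl | hl
  · exact absurd hl (main _ _ he h h')
  · exact hl
  · exact absurd hl (main _ _ he' h' h)

lemma kills_fun {V : Set (FreeGroup X)} {e : HEdge X} {v v'}
    (h : Kills V e v) (h' : Kills V e v') : v = v' := by
  obtain ⟨a, b, hab, hf, hv, hm, hd⟩ := h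
  obtain ⟨a', b', hab', hf', hv', hm', hd'⟩ := h'
  have : (a' = a ∧ b' = b) ∨ (a' = b ∧ b' = a) := by
    rcases hab with ⟨rfl, rfl⟩ | ⟨rfl, rfl⟩ <;> rcases hab' with ⟨rfl, rfl⟩ | ⟨rfl, rfl⟩ <;> simp
  rcases this with ⟨rfl, rfl⟩ | ⟨rfl, rfl⟩
  · exact le_antisymm (hm _ hv') (hm' _ hv)
  · exfalso
    rcases hd with hd | ⟨w, hw, hwv⟩
    · exact hd hf'
    rcases hd' with hd' | ⟨w', hw', hwv'⟩
    · exact hd' hf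
    have h1 := hm' _ hw
    have h2 := hm _ hw'
    exact absurd ((h1.trans_lt hwv).trans_le h2) hwv'.not_gt


lemma sm_lt_iff
    (hE : ∀ (g : FreeGroup X) (e e' : HEdge X), e < e' → sm g e < sm g e')
    (g : FreeGroup X) (e e' : HEdge X) : sm g e < sm g e' ↔ e < e' := by
  constructor
  · intro h
    have := hE g⁻¹ _ _ h
    rwa [sm_inv_sm, sm_inv_sm] at this
  · exact hE g e e'

lemma Tree.edg_iff {H : Subgroup (FreeGroup X)} {V : Set (FreeGroup X)} (T : Tree H V)
    {h} (hh : h ∈ H) (e) : e ∈ edg V ↔ sm h e ∈ edg V := by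
  constructor
  · exact T.invE hh
  · intro he
    have := T.invE (H.inv_mem hh) he
    rwa [sm_inv_sm] at this

lemma Tree.comp_lo
    (hE : ∀ (g : FreeGroup X) (e e' : HEdge X), e < e' → sm g e < sm g e')
    {H : Subgroup (FreeGroup X)} {V : Set (FreeGroup X)} (T : Tree H V)
    {h} (hh : h ∈ H) (e v) : comp (lo V (sm h e)) (h * v) = (fun w => h * w) '' comp (lo V e) v := by
  apply comp_smul
  intro e'
  unfold lo
  simp only [Set.mem_ofPred_eq]
  rw [sm_lt_iff hE, ← T.edg_iff hh]

lemma Tree.ess_smul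
    (hE : ∀ (g : FreeGroup X) (e e' : HEdge X), e < e' → sm g e < sm g e')
    {H : Subgroup (FreeGroup X)} {V : Set (FreeGroup X)} (T : Tree H V)
    {h} (hh : h ∈ H) {e} (he : e ∈ Ess V) : sm h e ∈ Ess V := by
  refine ⟨T.invE hh he.1, ?_, ?_⟩
  · rw [sm_s, T.comp_lo hE hh]
    exact he.2.1.image (mul_right_injective h).injOn
  · rw [sm_t, T.comp_lo hE hh]
    exact he.2.2.image (mul_right_injective h).injOn

lemma Tree.kills_smul
    (hF : ∀ a b c : FreeGroup X, a < b → c * a < c * b)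
    (hE : ∀ (g : FreeGroup X) (e e' : HEdge X), e < e' → sm g e < sm g e')
    {H : Subgroup (FreeGroup X)} {V : Set (FreeGroup X)} (T : Tree H V)
    {h} (hh : h ∈ H) {e v} (he : Kills V e v) : Kills V (sm h e) (h * v) := by
  obtain ⟨a, b, hab, hf, hv, hm, hd⟩ := he
  have hFle : ∀ a b c : FreeGroup X, a ≤ b → c * a ≤ c * b := by
    intro a b c hab
    rcases hab.lt_or_eq with h | rfl
    · exact (hF _ _ _ h).le
    · rfl
  refine ⟨h * a, h * b, hab.smul h, ?_⟩
  rw [T.comp_lo hE hh, T.comp_lo hE hh]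
  refine ⟨hf.image _, ⟨v, hv, rfl⟩, ?_, ?_⟩
  · rintro _ ⟨w, hw, rfl⟩
    exact hFle _ _ _ (hm w hw)
  · rcases hd with hd | ⟨w, hw, hwv⟩
    · exact Or.inl (hd.image (mul_right_injective h).injOn)
    · exact Or.inr ⟨_, ⟨w, hw, rfl⟩, hF _ _ _ hwv⟩

/-- Connectivity in a directed union of lower sets. -/
lemma conn_lower {V : Set (FreeGroup X)} {A : Set (HEdge X)} (hA : A ⊆ edg V)
    {u v : FreeGroup X} (h : Conn A u v) :
    u = v ∨ ∃ e ∈ A, Conn (loe V e) u v := by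
  induction h with
  | rel x y h =>
    obtain ⟨e, he, rfl, rfl⟩ := h
    exact Or.inr ⟨e, he, Conn.edge ⟨hA he, le_rfl⟩⟩
  | refl x => exact Or.inl rfl
  | symm x y _ ih =>
    rcases ih with rfl | ⟨e, he, h⟩
    · exact Or.inl rfl
    · exact Or.inr ⟨e, he, h.symm⟩
  | trans x y z _ _ h1 h2 =>
    rcases h1 with rfl | ⟨e, he, h⟩
    · exact h2
    rcases h2 with rfl | ⟨e', he', h'⟩
    · exact Or.inr ⟨e, he, h⟩
    rcases le_total e e' with hl | hl
    · exact Or.inr ⟨e', he', (h.mono (loe_mono hl)).trans h'⟩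
    · exact Or.inr ⟨e, he, h.trans (h'.mono (loe_mono hl))⟩

lemma Tree.exists_killer
    (hF : ∀ a b c : FreeGroup X, a < b → c * a < c * b)
    (hE : ∀ (g : FreeGroup X) (e e' : HEdge X), e < e' → sm g e < sm g e')
    {H : Subgroup (FreeGroup X)} {V : Set (FreeGroup X)} (T : Tree H V)
    (hH : H ≠ ⊥) {v} (hv : v ∈ V) : ∃ e ∈ edg V, Kills V e v := by
  classical
  let A : Set (HEdge X) := {e | e ∈ edg V ∧ (comp (loe V e) v).Finite ∧ ∀ w ∈ comp (loe V e) v, v ≤ w}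
  have hAsub : A ⊆ edg V := fun e he => he.1
  have hAlow : ∀ e ∈ A, ∀ e' ∈ edg V, e' ≤ e → e' ∈ A := by
    rintro e ⟨-, h2, h3⟩ e' he' hle
    have hs : comp (loe V e') v ⊆ comp (loe V e) v :=
      comp_mono (loe_mono hle) _
    exact ⟨he', h2.subset hs, fun w hw => h3 w (hs hw)⟩
  have hloeA : ∀ e ∈ A, loe V e ⊆ A := fun e he x hx => hAlow e he x hx.1 hx.2
  have hCmin : ∀ w ∈ comp A v, v ≤ w := by
    intro w hw
    rcases conn_lower hAsub hw with rfl | ⟨e, he, h⟩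
    · exact le_rfl
    · exact he.2.2 w h
  have hCV : comp A v ⊆ V := fun w hw => conn_mem hAsub hw hv
  have hlt : ∀ h ∈ H, h ≠ 1 → ∀ u, (h * u < u ∨ h⁻¹ * u < u) := by
    intro h hh h1 u
    rcases lt_trichotomy (h * u) u with hl | hl | hl
    · exact Or.inl hl
    · exact absurd (mul_eq_right.mp hl) h1
    · right
      have := hF _ _ h⁻¹ hl
      rwa [inv_mul_cancel_left] at this
  have hCfin : (comp A v).Finite := by
    by_contra hinf
    obtain ⟨u, hu, u', hu', hne, hq⟩ := Set.Infinite.exists_ne_map_eq_of_mapsTo (f := q H)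
      hinf (fun w hw => Set.mem_image_of_mem (q H) (hCV hw)) T.finV
    obtain ⟨h, hh, rfl⟩ := q_eq.mp hq
    have key : ∀ g ∈ H, g ≠ 1 → ∀ u ∈ comp A v, g * u ∈ comp A v →
        (∀ e ∈ A, sm g e ∈ A) → False := by
      intro g hg hg1 u hu hgu hgA
      have hsub : ∀ w ∈ comp A v, g * w ∈ comp A v := by
        intro w hw
        have h1 : Conn A (g * u) (g * w) := Conn.smul g hgA (Conn.trans (Conn.symm hu) hw)
        exact Conn.trans hgu h1
      by_cases hall : ∀ e ∈ A, sm g⁻¹ e ∈ A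
      · have h1 : Conn A (g⁻¹ * (g * u)) (g⁻¹ * v) :=
          Conn.smul g⁻¹ hall (Conn.symm hgu)
        rw [inv_mul_cancel_left] at h1
        have h2 : g⁻¹ * v ∈ comp A v := Conn.trans hu h1
        have h3 : g * v ∈ comp A v := hsub v (Conn.refl _ _)
        rcases hlt g hg hg1 v with hl | hl
        · exact absurd (hCmin _ h3) hl.not_ge
        · exact absurd (hCmin _ h2) hl.not_ge
      · push Not at hall
        obtain ⟨e, he, hne⟩ := hall
        have hbelow : ∀ e' ∈ A, sm g e' < e := by
          intro e' he'
          by_contra hcon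
          rw [not_lt] at hcon
          apply hne
          refine hAlow e' he' _ (T.invE (H.inv_mem hg) he.1) ?_
          rcases hcon.lt_or_eq with hl | rfl
          · have := hE g⁻¹ _ _ hl
            rw [sm_inv_sm] at this
            exact this.le
          · rw [sm_inv_sm]
        have hgv : g * v ∈ comp A v := hsub v (Conn.refl _ _)
        obtain ⟨e1, he1, hle1, hc1⟩ : ∃ e1 ∈ A, e ≤ e1 ∧ Conn (loe V e1) v (g * v) := by
          rcases conn_lower hAsub hgv with h0 | ⟨e2, he2, h0⟩
          · exact ⟨e, he, le_rfl, h0 ▸ Conn.refl _ _⟩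
          · rcases le_total e e2 with hl | hl
            · exact ⟨e2, he2, hl, h0⟩
            · exact ⟨e, he, le_rfl, h0.mono (loe_mono hl)⟩
        have hs : (fun w => g * w) '' comp A v ⊆ comp (loe V e1) v := by
          rintro _ ⟨w, hw, rfl⟩
          refine Conn.trans hc1 (Conn.smul g ?_ hw)
          intro e' he'
          exact ⟨T.invE hg he'.1, (hbelow e' he').le.trans hle1⟩
        have hinf' : (comp A v).Infinite := hinf
        exact (hinf'.image (mul_right_injective g).injOn) (he1.2.1.subset hs)
    have hh1 : h ≠ 1 := by rintro rfl; simp at hne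
    by_cases hall : ∀ e ∈ A, sm h e ∈ A
    · exact key h hh hh1 u hu hu' hall
    · refine key h⁻¹ (H.inv_mem hh) (inv_ne_one.mpr hh1) (h * u) hu' (by simpa using hu) ?_
      push Not at hall
      obtain ⟨e, he, hne⟩ := hall
      intro e' he'
      by_contra hcon
      apply hne
      have hlt' : e < sm h⁻¹ e' := by
        by_contra hc
        rw [not_lt] at hc
        exact hcon (hAlow e he _ (T.invE (H.inv_mem hh) he'.1) hc)
      have := hE h _ _ hlt'
      rw [sm_sm_inv] at this
      exact hAlow e' he' _ (T.invE hh he.1) this.le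
  let Bd : Set (HEdge X) := {e | e ∈ edg V ∧ ∃ a b, Ends e a b ∧ a ∈ comp A v ∧ b ∉ comp A v}
  have hBne : Bd.Nonempty := by
    obtain ⟨h, hh, hh1⟩ := (Subgroup.ne_bot_iff_exists_ne_one).mp hH |>.elim
      (fun a ha => (⟨a, a.2, fun h => ha (Subtype.ext h)⟩ : ∃ h : FreeGroup X, h ∈ H ∧ h ≠ 1))
    obtain ⟨w, hwV, hw⟩ : ∃ w ∈ V, w < v := by
      rcases hlt h hh hh1 v with hl | hl
      · exact ⟨_, T.inv _ hh _ hv, hl⟩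
      · exact ⟨_, T.inv _ (H.inv_mem hh) _ hv, hl⟩
    by_contra hB
    have hwC : w ∉ comp A v := fun h => absurd (hCmin w h) hw.not_ge
    apply hwC
    have := (T.conn v hv w hwV).inv (fun g => g ∈ comp A v) (by
      intro e he
      by_contra hcon
      apply hB
      by_cases h1 : e.s ∈ comp A v
      · have h2 : e.t ∉ comp A v := fun h2 => hcon (by simp [h1, h2])
        exact ⟨e, he, _, _, Or.inl ⟨rfl, rfl⟩, h1, h2⟩
      · have h2 : e.t ∈ comp A v := by
          by_contra h2
          exact hcon (by simp [h1, h2])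
        exact ⟨e, he, _, _, Or.inr ⟨rfl, rfl⟩, h2, h1⟩)
    rw [← this]
    exact Conn.refl _ _
  have hBfin : Bd.Finite := by
    let XF : Set X := Prod.snd '' (qe H '' edg V)
    have hXF : XF.Finite := T.finE.image _
    have hs : Bd ⊆ (fun p : FreeGroup X × X => (⟨p.1, p.2⟩ : HEdge X)) '' (comp A v ×ˢ XF) ∪
        (fun p : FreeGroup X × X => (⟨p.1 * (FreeGroup.of p.2)⁻¹, p.2⟩ : HEdge X)) '' (comp A v ×ˢ XF) := by
      rintro e ⟨he, a, b, hab, ha, hb⟩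
      have hx : e.x ∈ XF := ⟨_, ⟨e, he, rfl⟩, rfl⟩
      rcases hab with ⟨rfl, rfl⟩ | ⟨rfl, rfl⟩
      · left; exact ⟨(e.s, e.x), ⟨ha, hx⟩, rfl⟩
      · right; exact ⟨(e.t, e.x), ⟨ha, hx⟩, by simp [HEdge.t]⟩
    exact (((hCfin.prod hXF).image _).union ((hCfin.prod hXF).image _)).subset hs
  obtain ⟨e, ⟨he, a, b, hab, ha, hb⟩, hmin⟩ := Set.exists_min_image Bd id hBfin hBne
  have heA : e ∉ A := fun h => hb (Conn.trans ha (hab.conn h))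
  have hAlt : A ⊆ lo V e := by
    intro e' he'
    refine ⟨he'.1, ?_⟩
    by_contra hc
    rw [not_lt] at hc
    exact heA (hAlow e' he' e he hc)
  have hCeq : comp (lo V e) v = comp A v := by
    apply Set.Subset.antisymm
    · intro w hw
      have := Conn.inv hw (fun g => g ∈ comp A v) (by
        intro e' he'
        by_contra hcon
        have hB' : e' ∈ Bd := by
          by_cases h1 : e'.s ∈ comp A v
          · have h2 : e'.t ∉ comp A v := fun h2 => hcon (by simp [h1, h2])
            exact ⟨he'.1, _, _, Or.inl ⟨rfl, rfl⟩, h1, h2⟩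
          · have h2 : e'.t ∈ comp A v := by
              by_contra h2
              exact hcon (by simp [h1, h2])
            exact ⟨he'.1, _, _, Or.inr ⟨rfl, rfl⟩, h2, h1⟩
        exact absurd (hmin e' hB') he'.2.not_ge)
      rw [← this]
      exact Conn.refl _ _
    · exact comp_mono hAlt _
  have hva : Conn (lo V e) v a := Conn.mono hAlt ha
  have hCa : comp (lo V e) a = comp A v := by rw [← comp_eq hva, hCeq]
  refine ⟨e, he, a, b, hab, ?_, ?_, ?_, ?_⟩
  · rw [hCa]; exact hCfin
  · exact Conn.symm hva
  · rw [hCa]; exact hCmin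
  · by_contra hcon
    push Not at hcon
    obtain ⟨hbf, hbm⟩ := hcon
    have hU : comp (loe V e) v ⊆ comp A v ∪ comp (lo V e) b := by
      intro w hw
      have := Conn.inv hw (fun g => g ∈ comp A v ∪ comp (lo V e) b) (by
        intro e' he'
        rcases he'.2.lt_or_eq with hl | rfl
        · rw [← hCa]
          have hc : Conn (lo V e) e'.s e'.t := Conn.edge ⟨he'.1, hl⟩
          apply propext
          constructor
          · rintro (h | h)
            · exact Or.inl (Conn.trans h hc)
            · exact Or.inr (Conn.trans h hc)
          · rintro (h | h)
            · exact Or.inl (Conn.trans h hc.symm)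
            · exact Or.inr (Conn.trans h hc.symm)
        · have hbb : b ∈ comp (lo V e') b := Conn.refl _ _
          rcases hab with ⟨rfl, rfl⟩ | ⟨rfl, rfl⟩
          · simp [ha, hbb]
          · simp [ha, hbb])
      rw [← this]
      exact Or.inl (Conn.refl _ _)
    apply heA
    refine ⟨he, ?_, ?_⟩
    · refine (hCfin.union ?_).subset hU
      exact hbf
    · intro w hw
      rcases hU hw with h | h
      · exact hCmin w h
      · exact hbm w h

lemma ncard_rel {α β α' β' : Type*} {A : Set α} {B : Set β} (p : α → α') (r : β → β')
    (R : α → β → Prop) (h1 : ∀ a ∈ A, ∃ b ∈ B, R a b) (h2 : ∀ b ∈ B, ∃ a ∈ A, R a b)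
    (h3 : ∀ a ∈ A, ∀ b ∈ B, ∀ a' ∈ A, ∀ b' ∈ B, R a b → R a' b' → (p a = p a' ↔ r b = r b')) :
    (p '' A).ncard = (r '' B).ncard := by
  choose f hfB hfR using h1
  refine Set.ncard_congr (fun a' ha' => r (f ha'.choose ha'.choose_spec.1)) ?_ ?_ ?_
  · intro a' ha'
    exact ⟨_, hfB _ _, rfl⟩
  · intro a' b' ha' hb' h
    rw [← ha'.choose_spec.2, ← hb'.choose_spec.2]
    exact (h3 _ ha'.choose_spec.1 _ (hfB _ _) _ hb'.choose_spec.1 _ (hfB _ _) (hfR _ _) (hfR _ _)).mpr h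
  · rintro _ ⟨b, hb, rfl⟩
    obtain ⟨a, ha, hR⟩ := h2 b hb
    have hm : p a ∈ p '' A := ⟨a, ha, rfl⟩
    refine ⟨p a, hm, ?_⟩
    exact (h3 _ hm.choose_spec.1 _ (hfB _ _) _ ha _ hb (hfR _ _) hR).mp hm.choose_spec.2

theorem Tree.count
    (hF : ∀ a b c : FreeGroup X, a < b → c * a < c * b)
    (hE : ∀ (g : FreeGroup X) (e e' : HEdge X), e < e' → sm g e < sm g e')
    {H : Subgroup (FreeGroup X)} {V : Set (FreeGroup X)} (T : Tree H V)
    (hH : H ≠ ⊥) : (qe H '' edg V).ncard = (q H '' V).ncard + (qe H '' Ess V).ncard := by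
  have h1 : (qe H '' (edg V \ Ess V)).ncard = (q H '' V).ncard := by
    refine ncard_rel (qe H) (q H) (Kills V) ?_ ?_ ?_
    · rintro e ⟨he, hn⟩; exact exists_kills he hn
    · intro v hv
      obtain ⟨e, he, h⟩ := T.exists_killer hF hE hH hv
      exact ⟨e, ⟨he, h.not_ess⟩, h⟩
    · intro e he v hv e' he' v' hv' h h'
      rw [qe_eq, q_eq]
      constructor
      · rintro ⟨g, hg, rfl⟩
        exact ⟨g, hg, kills_fun h' (T.kills_smul hF hE hg h)⟩
      · rintro ⟨g, hg, rfl⟩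
        exact ⟨g, hg, kills_inj he'.1 (T.invE hg he.1) h' (T.kills_smul hF hE hg h)⟩
  have hsub : Ess V ⊆ edg V := fun e he => he.1
  have f1 : (qe H '' (edg V \ Ess V)).Finite := T.finE.subset (Set.image_mono Set.sdiff_subset)
  have f2 : (qe H '' Ess V).Finite := T.finE.subset (Set.image_mono hsub)
  rw [← h1, ← Set.ncard_union_eq ?_ f1 f2, ← Set.image_union, Set.sdiff_union_of_subset hsub]
  · rw [Set.disjoint_left]
    rintro _ ⟨e, he, rfl⟩ ⟨e', he', h⟩
    obtain ⟨g, hg, rfl⟩ := qe_eq.mp h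
    exact he.2 (T.ess_smul hE hg he')

lemma ess_mono {V W : Set (FreeGroup X)} (h : V ⊆ W) : Ess V ⊆ Ess W := by
  have h1 : edg V ⊆ edg W := fun e he => ⟨h he.1, h he.2⟩
  have h2 : ∀ e, lo V e ⊆ lo W e := fun e x hx => ⟨h1 hx.1, hx.2⟩
  rintro e ⟨he, ha, hb⟩
  exact ⟨h1 he, ha.mono (comp_mono (h2 e) _), hb.mono (comp_mono (h2 e) _)⟩

end kruskal
end HN

namespace HN


section trees
variable {X : Type u}

def Good (V : Set (FreeGroup X)) (u : FreeGroup X) (L : List (X × Bool)) : Prop :=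
  ∀ p, p <+: L → u * FreeGroup.mk p ∈ V

lemma mk_cons (a : X × Bool) (L : List (X × Bool)) :
    FreeGroup.mk (a :: L) = FreeGroup.mk [a] * FreeGroup.mk L := by
  simp [FreeGroup.mul_mk]

lemma Good.conn {V : Set (FreeGroup X)} {u : FreeGroup X} {L : List (X × Bool)} (h : Good V u L) :
    Conn (edg V) u (u * FreeGroup.mk L) := by
  induction L generalizing u with
  | nil => rw [← FreeGroup.one_eq_mk, mul_one]; exact Conn.refl _ _
  | cons a L ih =>
    have hu : u ∈ V := by
      have := h [] (List.nil_prefix)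
      rwa [← FreeGroup.one_eq_mk, mul_one] at this
    have hu' : u * FreeGroup.mk [a] ∈ V := h [a] (by simp)
    have h1 : Good V (u * FreeGroup.mk [a]) L := by
      intro p hp
      have := h (a :: p) (by simpa using hp)
      rwa [mk_cons, ← mul_assoc] at this
    have h2 := ih h1
    rw [mk_cons, ← mul_assoc]
    refine Conn.trans ?_ h2
    obtain ⟨x, b⟩ := a
    cases b with
    | true =>
      exact Conn.edge (S := edg V) (e := ⟨u, x⟩) ⟨hu, hu'⟩
    | false =>
      have e1 : FreeGroup.mk [(x, false)] = (FreeGroup.of x)⁻¹ := rfl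
      rw [e1] at hu' ⊢
      have := Conn.edge (S := edg V) (e := ⟨u * (FreeGroup.of x)⁻¹, x⟩) ⟨hu', by simpa [HEdge.t] using hu⟩
      simpa [HEdge.t] using this.symm

lemma conn_good {V : Set (FreeGroup X)} {u v : FreeGroup X} (hu : u ∈ V) (h : Conn (edg V) u v) :
    ∃ L, u * FreeGroup.mk L = v ∧ Good V u L := by
  have happ : ∀ L a, Good V u L → u * FreeGroup.mk (L ++ [a]) ∈ V → Good V u (L ++ [a]) := by
    intro L a hL ha p hp
    rcases List.prefix_concat_iff.mp hp with rfl | hp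
    · exact ha
    · exact hL p hp
  have := h.inv (fun v => ∃ L, u * FreeGroup.mk L = v ∧ Good V u L) (by
    intro e he
    apply propext
    constructor
    · rintro ⟨L, h1, h2⟩
      have e1 : u * FreeGroup.mk (L ++ [(e.x, true)]) = e.t := by
        rw [← FreeGroup.mul_mk, ← mul_assoc, h1]; rfl
      exact ⟨_, e1, happ _ _ h2 (e1 ▸ he.2)⟩
    · rintro ⟨L, h1, h2⟩
      have e0 : FreeGroup.mk [(e.x, false)] = (FreeGroup.of e.x)⁻¹ := rfl
      have e1 : u * FreeGroup.mk (L ++ [(e.x, false)]) = e.s := by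
        rw [← FreeGroup.mul_mk, ← mul_assoc, h1, e0]; simp [HEdge.t]
      exact ⟨_, e1, happ _ _ h2 (e1 ▸ he.1)⟩)
  rw [← this]
  refine ⟨[], by rw [← FreeGroup.one_eq_mk, mul_one], ?_⟩
  intro p hp
  rw [List.prefix_nil] at hp
  subst hp
  rwa [← FreeGroup.one_eq_mk, mul_one]

lemma Good.step {V : Set (FreeGroup X)} {u : FreeGroup X} {L L' : List (X × Bool)} (h : Good V u L)
    (hs : FreeGroup.Red.Step L L') : Good V u L' := by
  obtain ⟨⟩ := hs
  rename_i L1 L2 x b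
  intro p hp
  obtain ⟨s, hs⟩ := hp
  rcases List.append_eq_append_iff.mp hs with ⟨a, rfl, -⟩ | ⟨p', rfl, rfl⟩
  · exact h p (by rw [List.append_assoc]; exact List.prefix_append _ _)
  · have := h (L1 ++ (x, b) :: (x, !b) :: p') (by
      rw [List.prefix_append_right_inj]
      simp)
    have e : FreeGroup.mk (L1 ++ (x, b) :: (x, !b) :: p') = FreeGroup.mk (L1 ++ p') :=
      Quot.sound FreeGroup.Red.Step.not
    rwa [e] at this

lemma Good.red {V : Set (FreeGroup X)} {u : FreeGroup X} {L L' : List (X × Bool)} (h : Good V u L)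
    (hs : FreeGroup.Red L L') : Good V u L' := by
  induction hs with
  | refl => exact h
  | tail _ hs ih => exact ih.step hs

lemma finite_map {α α' β : Type*} {A : Set α} (p : α → α') (f : α → β) {S : Set β} (hS : S.Finite)
    (hf : ∀ a ∈ A, f a ∈ S) (h : ∀ a ∈ A, ∀ b ∈ A, f a = f b → p a = p b) :
    (p '' A).Finite ∧ (p '' A).ncard ≤ S.ncard := by
  rcases A.eq_empty_or_nonempty with rfl | ⟨a0, ha0⟩
  · simp
  have : Nonempty α := ⟨a0⟩
  have hs : p '' A ⊆ (fun b => p (Function.invFunOn f A b)) '' S := by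
    rintro _ ⟨a, ha, rfl⟩
    refine ⟨f a, hf a ha, ?_⟩
    have hex : ∃ b ∈ A, f b = f a := ⟨a, ha, rfl⟩
    exact h _ (Function.invFunOn_mem hex) _ ha (Function.invFunOn_eq hex)
  exact ⟨(hS.image _).subset hs, (Set.ncard_le_ncard hs (hS.image _)).trans (Set.ncard_image_le hS)⟩

lemma q_inf {H K : Subgroup (FreeGroup X)} {a b : FreeGroup X} (h1 : q H a = q H b)
    (h2 : q K a = q K b) : q (H ⊓ K) a = q (H ⊓ K) b := by
  obtain ⟨h, hh, e⟩ := q_eq.mp h1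
  obtain ⟨h', hh', e'⟩ := q_eq.mp h2
  rw [e] at e'
  have := mul_right_cancel e'
  subst this
  exact q_eq.mpr ⟨h, ⟨hh, hh'⟩, e⟩

lemma qe_inf {H K : Subgroup (FreeGroup X)} {a b : HEdge X} (h1 : qe H a = qe H b)
    (h2 : qe K a = qe K b) : qe (H ⊓ K) a = qe (H ⊓ K) b := by
  simp only [qe, Prod.mk.injEq] at *
  exact ⟨q_inf h1.1 h2.1, h1.2⟩

lemma edg_mono {V W : Set (FreeGroup X)} (h : V ⊆ W) : edg V ⊆ edg W :=
  fun _ he => ⟨h he.1, h he.2⟩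

lemma Tree.inter {H K : Subgroup (FreeGroup X)} {V W : Set (FreeGroup X)} (T : Tree H V)
    (T' : Tree K W) : Tree (H ⊓ K) (V ∩ W) where
  one := ⟨T.one, T'.one⟩
  inv h hh v hv := ⟨T.inv h hh.1 v hv.1, T'.inv h hh.2 v hv.2⟩
  conn := by
    classical
    have main : ∀ {H : Subgroup (FreeGroup X)} {V} (_ : Tree H V) u v, u ∈ V → v ∈ V →
        Good V u (FreeGroup.toWord (u⁻¹ * v)) := by
      intro H V T u v hu hv
      obtain ⟨L, h1, h2⟩ := conn_good hu (T.conn u hu v hv)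
      rw [← h1, inv_mul_cancel_left, FreeGroup.toWord_mk]
      exact h2.red FreeGroup.reduce.red
    intro u hu v hv
    have h : Good (V ∩ W) u (FreeGroup.toWord (u⁻¹ * v)) := fun p hp =>
      ⟨main T u v hu.1 hv.1 p hp, main T' u v hu.2 hv.2 p hp⟩
    have := h.conn
    rwa [FreeGroup.mk_toWord, mul_inv_cancel_left] at this
  finV := (finite_map (q (H ⊓ K)) (fun g => (q H g, q K g)) (T.finV.prod T'.finV)
    (fun a ha => ⟨⟨a, ha.1, rfl⟩, ⟨a, ha.2, rfl⟩⟩) (by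
      intro a _ b _ h
      rw [Prod.mk.injEq] at h
      exact q_inf h.1 h.2)).1
  finE := (finite_map (qe (H ⊓ K)) (fun g => (qe H g, qe K g)) (T.finE.prod T'.finE)
    (fun a ha => ⟨⟨a, edg_mono Set.inter_subset_left ha, rfl⟩,
      ⟨a, edg_mono Set.inter_subset_right ha, rfl⟩⟩) (by
      intro a _ b _ h
      rw [Prod.mk.injEq] at h
      exact qe_inf h.1 h.2)).1

theorem exists_tree (H : Subgroup (FreeGroup X)) (r : ℕ) (φ : FreeGroup (Fin r) ≃* H) :
    ∃ V, Tree H V := by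
  classical
  let b : Fin r → FreeGroup X := fun i => φ (FreeGroup.of i)
  let P : Set (List (X × Bool)) := {[]} ∪ ⋃ i, {p | p <+: (b i).toWord}
  have hPfin : P.Finite := by
    refine (Set.finite_singleton _).union (Set.finite_iUnion ?_)
    intro i
    have : {p | p <+: (b i).toWord} = {p | p ∈ (b i).toWord.inits} := by
      ext p; simp
    rw [this]
    exact List.finite_toSet _
  let V : Set (FreeGroup X) := {g | ∃ h ∈ H, ∃ p ∈ P, g = h * FreeGroup.mk p}
  have hinv : ∀ h ∈ H, ∀ v ∈ V, h * v ∈ V := by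
    rintro h hh _ ⟨h', hh', p, hp, rfl⟩
    exact ⟨h * h', H.mul_mem hh hh', p, hp, by rw [mul_assoc]⟩
  have hHV : ∀ h ∈ H, h ∈ V := fun h hh => ⟨h, hh, [], Or.inl rfl, by
    rw [← FreeGroup.one_eq_mk, mul_one]⟩
  have hgood : ∀ h ∈ H, ∀ p ∈ P, Good V h p := by
    intro h hh p hp p' hp'
    refine ⟨h, hh, p', ?_, rfl⟩
    rcases hp with hp | hp
    · rw [Set.mem_singleton_iff] at hp
      subst hp
      rw [List.prefix_nil] at hp'
      exact Or.inl hp'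
    · right
      rw [Set.mem_iUnion] at hp ⊢
      obtain ⟨i, hi⟩ := hp
      exact ⟨i, List.IsPrefix.trans hp' hi⟩
  have hbP : ∀ i, (b i).toWord ∈ P := by
    intro i
    right
    rw [Set.mem_iUnion]
    exact ⟨i, List.prefix_refl _⟩
  have hconnb : ∀ u ∈ H, ∀ i, Conn (edg V) u (u * b i) := by
    intro u hu i
    have := (hgood u hu _ (hbP i)).conn
    rwa [FreeGroup.mk_toWord] at this
  have hconnH : ∀ w : FreeGroup (Fin r), ∀ u ∈ H, Conn (edg V) u (u * φ w) := by
    intro w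
    induction w using FreeGroup.induction_on with
    | C1 => intro u hu; simpa using Conn.refl _ _
    | of i => intro u hu; exact hconnb u hu i
    | inv_of i _ =>
      intro u hu
      have := hconnb (u * (b i)⁻¹) (H.mul_mem hu (H.inv_mem (φ _).2)) i
      rw [inv_mul_cancel_right] at this
      rw [map_inv]
      exact this.symm
    | mul y z hy hz =>
      intro u hu
      have := (hy u hu).trans (hz (u * φ y) (H.mul_mem hu (φ y).2))
      rwa [mul_assoc, ← Subgroup.coe_mul, ← map_mul] at this
  have hconn1 : ∀ v ∈ V, Conn (edg V) 1 v := by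
    rintro _ ⟨h, hh, p, hp, rfl⟩
    have h1 := hconnH (φ.symm ⟨h, hh⟩) 1 H.one_mem
    rw [one_mul, MulEquiv.apply_symm_apply] at h1
    exact h1.trans (hgood h hh p hp).conn
  let X0 : Set X := ⋃ i, {x | ∃ c, (x, c) ∈ (b i).toWord}
  have hX0 : X0.Finite := by
    refine Set.finite_iUnion ?_
    intro i
    refine ((List.finite_toSet (b i).toWord).image Prod.fst).subset ?_
    rintro x ⟨c, hc⟩
    exact ⟨_, hc, rfl⟩
  let π : FreeGroup X →* FreeGroup X := FreeGroup.lift (fun x => if x ∈ X0 then 1 else FreeGroup.of x)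
  have hπof : ∀ x ∈ X0, π (FreeGroup.of x) = 1 := by
    intro x hx; simp [π, hx]
  have hπmk : ∀ p : List (X × Bool), (∀ a ∈ p, a.1 ∈ X0) → π (FreeGroup.mk p) = 1 := by
    intro p
    induction p with
    | nil => intro _; rw [← FreeGroup.one_eq_mk, map_one]
    | cons a p ih =>
      intro h
      rw [mk_cons, map_mul, ih (fun a ha => h a (List.mem_cons_of_mem _ ha)), mul_one]
      obtain ⟨x, c⟩ := a
      have hx := hπof x (h (x, c) List.mem_cons_self)
      cases c with
      | true => exact hx
      | false =>
        have e1 : FreeGroup.mk [(x, false)] = (FreeGroup.of x)⁻¹ := rfl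
        rw [e1, map_inv, hx, inv_one]
  have hπP : ∀ p ∈ P, π (FreeGroup.mk p) = 1 := by
    intro p hp
    apply hπmk
    rintro ⟨x, c⟩ ha
    rcases hp with hp | hp
    · rw [Set.mem_singleton_iff] at hp
      subst hp
      simp at ha
    · rw [Set.mem_iUnion] at hp
      obtain ⟨i, hi⟩ := hp
      exact Set.mem_iUnion.mpr ⟨i, c, List.IsPrefix.subset hi ha⟩
  have hπH : ∀ h ∈ H, π h = 1 := by
    have : (π.comp (H.subtype.comp φ.toMonoidHom)) = 1 := by
      ext1 i
      have := hπP _ (hbP i)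
      rw [FreeGroup.mk_toWord] at this
      exact this
    intro h hh
    have := DFunLike.congr_fun this (φ.symm ⟨h, hh⟩)
    simpa using this
  have hπV : ∀ v ∈ V, π v = 1 := by
    rintro _ ⟨h, hh, p, hp, rfl⟩
    rw [map_mul, hπH h hh, hπP p hp, mul_one]
  have hfinV : (q H '' V).Finite := by
    refine (hPfin.image (fun p => q H (FreeGroup.mk p))).subset ?_
    rintro _ ⟨_, ⟨h, hh, p, hp, rfl⟩, rfl⟩
    exact ⟨p, hp, q_eq.mpr ⟨h, hh, rfl⟩⟩
  refine ⟨V, ?_, hinv, ?_, hfinV, ?_⟩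
  · exact hHV 1 H.one_mem
  · intro u hu v hv
    exact (hconn1 u hu).symm.trans (hconn1 v hv)
  · refine (hfinV.prod hX0).subset ?_
    rintro _ ⟨e, he, rfl⟩
    refine ⟨⟨e.s, he.1, rfl⟩, ?_⟩
    by_contra hx
    have h1 := hπV _ he.1
    have h2 := hπV _ he.2
    rw [HEdge.t, map_mul, h1, one_mul] at h2
    have hx' : e.x ∉ X0 := hx
    simp [π, hx'] at h2

theorem exists_edgeOrder (X : Type u) [LinearOrder (FreeGroup X)]
    (hF : ∀ a b c : FreeGroup X, a < b → c * a < c * b) :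
    ∃ lo : LinearOrder (HEdge X), ∀ (g : FreeGroup X) (e e' : HEdge X),
      lo.lt e e' → lo.lt (sm g e) (sm g e') := by
  obtain ⟨l0, hl0⟩ := exists_wellFoundedLT X
  let f : HEdge X → FreeGroup X ×ₗ X := fun e => toLex (e.s, e.x)
  have hf : Function.Injective f := by
    intro a b h
    have h1 := congrArg (fun p => (ofLex p).1) h
    have h2 := congrArg (fun p => (ofLex p).2) h
    exact HEdge.ext h1 h2
  refine ⟨LinearOrder.lift' f hf, ?_⟩
  intro g e e' h
  change f _ < f _ at h
  change f _ < f _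
  rw [Prod.Lex.lt_iff] at h ⊢
  rcases h with h | ⟨h1, h2⟩
  · left; exact hF _ _ _ h
  · right; exact ⟨congrArg (g * ·) h1, h2⟩

theorem hn_free (H K : Subgroup (FreeGroup X)) (r₁ r₂ : ℕ)
    (e₁ : FreeGroup (Fin r₁) ≃* H) (e₂ : FreeGroup (Fin r₂) ≃* K) :
    ∃ r : ℕ, Nonempty (FreeGroup (Fin r) ≃* ↥(H ⊓ K)) ∧
      r - 1 ≤ (r₁ - 1) * (r₂ - 1) := by
  by_cases hM : H ⊓ K = ⊥
  · refine ⟨0, ?_, by simp⟩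
    rw [hM]
    exact ⟨MulEquiv.ofUnique⟩
  have hH : H ≠ ⊥ := by rintro rfl; simp at hM
  have hK : K ≠ ⊥ := by rintro rfl; simp at hM
  obtain ⟨lF, hF⟩ := exists_leftOrder (X := X)
  obtain ⟨lE, hE⟩ := exists_edgeOrder X hF
  obtain ⟨V, T⟩ := exists_tree H r₁ e₁
  obtain ⟨W, T'⟩ := exists_tree K r₂ e₂
  have TM := T.inter T'
  obtain ⟨-, h1⟩ := euler T e₁
  obtain ⟨-, h2⟩ := euler T' e₂
  obtain ⟨hfin, h3⟩ := euler TM (IsFreeGroup.mulEquiv (H ⊓ K : Subgroup (FreeGroup X)))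
  have c1 := T.count hF hE hH
  have c2 := T'.count hF hE hK
  have c3 := TM.count hF hE hM
  refine ⟨Nat.card (IsFreeGroup.Generators (H ⊓ K : Subgroup (FreeGroup X))),
    ⟨(FreeGroup.freeGroupCongr (Finite.equivFin _).symm).trans (IsFreeGroup.mulEquiv _)⟩, ?_⟩
  rw [Nat.card_fin] at h1 h2
  have f1 : (qe H '' Ess V).Finite := T.finE.subset (Set.image_mono fun e he => he.1)
  have f2 : (qe K '' Ess W).Finite := T'.finE.subset (Set.image_mono fun e he => he.1)
  have key := (finite_map (A := Ess (V ∩ W)) (qe (H ⊓ K)) (fun g => (qe H g, qe K g)) (f1.prod f2)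
    (fun a ha => ⟨⟨a, ess_mono Set.inter_subset_left ha, rfl⟩,
      ⟨a, ess_mono Set.inter_subset_right ha, rfl⟩⟩) (by
      intro a _ b _ h
      rw [Prod.mk.injEq] at h
      exact qe_inf h.1 h.2)).2
  rw [Set.ncard_prod] at key
  have a1 : r₁ - 1 = (qe H '' Ess V).ncard := by omega
  have a2 : r₂ - 1 = (qe K '' Ess W).ncard := by omega
  rw [a1, a2]
  omega

end trees
end HN

/-- **Hanna Neumann conjecture.** Let `H₁`, `H₂` be finitely generated subgroups of a
free group `F` (free of ranks `r₁`, `r₂`, by Nielsen–Schreier). Then `H₁ ∩ H₂` is free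
of some finite rank `r` and `r̄(H₁ ∩ H₂) ≤ r̄(H₁) ⬝ r̄(H₂)`, where `r̄` denotes the
reduced rank `max(rank − 1, 0)` (natural subtraction). -/
theorem hanna_neumann {F : Type*} [Group F] [IsFreeGroup F]
    (H₁ H₂ : Subgroup F) (r₁ r₂ : ℕ)
    (e₁ : FreeGroup (Fin r₁) ≃* H₁) (e₂ : FreeGroup (Fin r₂) ≃* H₂) :
    ∃ r : ℕ, Nonempty (FreeGroup (Fin r) ≃* ↥(H₁ ⊓ H₂)) ∧
      r - 1 ≤ (r₁ - 1) * (r₂ - 1) := by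
  let e : F ≃* FreeGroup (IsFreeGroup.Generators F) := (IsFreeGroup.mulEquiv F).symm
  have he : Function.Injective e.toMonoidHom := e.injective
  obtain ⟨r, ⟨φ⟩, hr⟩ := HN.hn_free (H₁.map e.toMonoidHom) (H₂.map e.toMonoidHom) r₁ r₂
    (e₁.trans (H₁.equivMapOfInjective _ he)) (e₂.trans (H₂.equivMapOfInjective _ he))
  refine ⟨r, ⟨?_⟩, hr⟩
  rw [← Subgroup.map_inf_eq _ _ _ he] at φ
  exact φ.trans ((H₁ ⊓ H₂).equivMapOfInjective _ he).symm
end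

section
/- Let H₁ and H₂ be finitely generated subgroups of a free group F. Then there are only finitely many double cosets H₁ t H₂, t ∈ F, with the property H₁ ∩ t H₂ t⁻¹ ≠ {1}, and if S(H₁, H₂) is any set of representatives of these double cosets, then Σ_{s ∈ S(H₁,H₂)} r̄(H₁ ∩ s H₂ s⁻¹) ≤ r̄(H₁) · r̄(H₂) (the strengthened Hanna Neumann conjecture). -/
open Finset

/-- The conjugate subgroup `t H t⁻¹`. -/
def conjSubgroup {F : Type*} [Group F] (t : F) (H : Subgroup F) : Subgroup F :=
  Subgroup.map (MulAut.conj t).toMonoidHom H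

/-- `s` and `t` lie in the same double coset `H₁ s H₂ = H₁ t H₂`. -/
def SameDoset {F : Type*} [Group F] (H₁ H₂ : Subgroup F) (s t : F) : Prop :=
  ∃ h₁ ∈ H₁, ∃ h₂ ∈ H₂, t = h₁ * s * h₂

/-- `S` is a set of representatives of those double cosets `H₁ t H₂` of `F`
that have the property `H₁ ∩ t H₂ t⁻¹ ≠ {1}`. -/
def IsDosetTransversal {F : Type*} [Group F] (H₁ H₂ : Subgroup F) (S : Set F) : Prop :=
  (∀ s ∈ S, H₁ ⊓ conjSubgroup s H₂ ≠ ⊥) ∧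
  (∀ s ∈ S, ∀ s' ∈ S, SameDoset H₁ H₂ s s' → s = s') ∧
  (∀ t : F, H₁ ⊓ conjSubgroup t H₂ ≠ ⊥ → ∃ s ∈ S, SameDoset H₁ H₂ s t)

set_option linter.style.haveILetI false
set_option linter.unusedSectionVars false

namespace SHN

section Order

open Classical in
/-- Left multiplication by `1 + a` on formal noncommutative power series. -/
noncomputable def act {α : Type*} (a : α) (f : List α → ℤ) : List α → ℤ
  | [] => f []
  | c :: w => f (c :: w) + if c = a then f w else 0

open Classical in
/-- Left multiplication by the inverse of `1 + a`. -/
noncomputable def actInv {α : Type*} (a : α) (f : List α → ℤ) : List α → ℤ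
  | [] => f []
  | c :: w => f (c :: w) - if c = a then actInv a f w else 0

noncomputable def actE {α : Type*} (a : α) : Equiv.Perm (List α → ℤ) where
  toFun := act a
  invFun := actInv a
  left_inv f := by
    funext w
    induction w with
    | nil => simp [actInv, act]
    | cons c w ih => 
      rw [actInv, ih, act]; ring
  right_inv f := by
    funext w
    cases w with
    | nil => simp [actInv, act]
    | cons c w => 
      rw [act, actInv]; ring

theorem actE_apply {α : Type*} (a : α) (f : List α → ℤ) : actE a f = act a f := rfl
theorem actE_inv_apply {α : Type*} (a : α) (f : List α → ℤ) : (actE a)⁻¹ f = actInv a f := rfl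

theorem act_pow {α : Type*} (a : α) (n : ℤ) : ∀ f : List α → ℤ,
    (∀ u : List α, u.head? ≠ some a → (actE a ^ n) f u = f u) ∧
    (∀ w : List α, w.head? ≠ some a → (actE a ^ n) f (a :: w) = f (a :: w) + n * f w) := by
  have h1 : ∀ (f : List α → ℤ) (u : List α), u.head? ≠ some a → act a f u = f u := by
    intro f u hu
    cases u with
    | nil => simp [act]
    | cons c w => 
      have : c ≠ a := by simpa using hu
      simp [act, this]
  have h2 : ∀ (f : List α → ℤ) (u : List α), u.head? ≠ some a → actInv a f u = f u := by
    intro f u hu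
    cases u with
    | nil => simp [actInv]
    | cons c w => 
      have : c ≠ a := by simpa using hu
      simp [actInv, this]
  induction n using Int.induction_on with
  | zero => intro f; simp
  | succ n ih =>
    intro f
    rw [zpow_add_one]
    constructor
    · intro u hu
      rw [Equiv.Perm.mul_apply, (ih _).1 u hu, actE_apply, h1 f u hu]
    · intro w hw
      rw [Equiv.Perm.mul_apply, (ih _).2 w hw, actE_apply, h1 f w hw]
      simp only [act, if_true]; ring
  | pred n ih =>
    intro f
    rw [zpow_sub_one]
    constructor
    · intro u hu
      rw [Equiv.Perm.mul_apply, (ih _).1 u hu, actE_inv_apply, h2 f u hu]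
    · intro w hw
      rw [Equiv.Perm.mul_apply, (ih _).2 w hw, actE_inv_apply, h2 f w hw]
      simp only [actInv, if_true, h2 f w hw]; ring

/-- The Magnus representation. -/
noncomputable def magnus (α : Type*) : FreeGroup α →* Equiv.Perm (List α → ℤ) :=
  FreeGroup.lift actE

open Classical in
noncomputable def delta (α : Type*) : List α → ℤ := fun w => if w = [] then 1 else 0

theorem syllables {α : Type*} (x : FreeGroup α) : ∃ l : List (α × ℤ), (∀ p ∈ l, p.2 ≠ 0) ∧
    l.IsChain (fun p q => p.1 ≠ q.1) ∧ x = (l.map (fun p => FreeGroup.of p.1 ^ p.2)).prod := by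
  have key : ∀ (a : α) (e : ℤ), e ≠ 0 → ∀ y : FreeGroup α, (∃ l : List (α × ℤ), (∀ p ∈ l, p.2 ≠ 0) ∧
    l.IsChain (fun p q => p.1 ≠ q.1) ∧ y = (l.map (fun p => FreeGroup.of p.1 ^ p.2)).prod) →
    (∃ l : List (α × ℤ), (∀ p ∈ l, p.2 ≠ 0) ∧
    l.IsChain (fun p q => p.1 ≠ q.1) ∧ FreeGroup.of a ^ e * y = (l.map (fun p => FreeGroup.of p.1 ^ p.2)).prod) := by
    rintro a e he y ⟨l, h1, h2, h3⟩
    cases l with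
    | nil => exact ⟨[(a, e)], by simpa using he, by simp, by simp [h3]⟩
    | cons p l =>
      obtain ⟨c, n⟩ := p
      by_cases hc : c = a
      · subst hc
        by_cases hn : e + n = 0
        · refine ⟨l, fun p hp => h1 p (by simp [hp]), h2.tail, ?_⟩
          rw [h3]
          simp only [List.map_cons, List.prod_cons, ← mul_assoc, ← zpow_add, hn]
          simp
        · refine ⟨(c, e + n) :: l, ?_, ?_, ?_⟩
          · intro p hp
            rcases List.mem_cons.1 hp with rfl | hp
            · exact hn
            · exact h1 p (by simp [hp])
          · rw [List.isChain_cons] at h2 ⊢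
            exact h2
          · rw [h3]
            simp only [List.map_cons, List.prod_cons, ← mul_assoc, ← zpow_add]
      · refine ⟨(a, e) :: (c, n) :: l, ?_, ?_, by simp [h3]⟩
        · intro p hp
          rcases List.mem_cons.1 hp with rfl | hp
          · exact he
          · exact h1 p hp
        · rw [List.isChain_cons_cons]
          exact ⟨fun h => hc h.symm, h2⟩
  have hx : x ∈ Subgroup.closure (Set.range (FreeGroup.of : α → FreeGroup α)) := by
    rw [FreeGroup.closure_range_of]; trivial
  induction hx using Subgroup.closure_induction_left with
  | one => exact ⟨[], by simp, by simp, by simp⟩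
  | mul_left a ha y _ ih => 
    obtain ⟨a, rfl⟩ := ha
    simpa using key a 1 (by simp) y ih
  | inv_mul_cancel a ha y _ ih =>
    obtain ⟨a, rfl⟩ := ha
    simpa using key a (-1) (by simp) y ih

theorem magnus_syll {α : Type*} (l : List (α × ℤ)) (h1 : ∀ p ∈ l, p.2 ≠ 0)
    (h2 : l.IsChain (fun p q => p.1 ≠ q.1)) :
    (magnus α (l.map (fun p => FreeGroup.of p.1 ^ p.2)).prod (delta α) (l.map Prod.fst) ≠ 0) ∧
    ∀ v : List α, v.IsChain (· ≠ ·) → l.length < v.length →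
      magnus α (l.map (fun p => FreeGroup.of p.1 ^ p.2)).prod (delta α) v = 0 := by
  induction l with
  | nil =>
    refine ⟨by simp [delta], ?_⟩
    intro v _ hv
    have : v ≠ [] := by rintro rfl; simp at hv
    simp [delta, this]
  | cons p l ih =>
    obtain ⟨a, n⟩ := p
    obtain ⟨i1, i2⟩ := ih (fun p hp => h1 p (by simp [hp])) h2.tail
    have hn : n ≠ 0 := h1 (a, n) (by simp)
    set f := magnus α (l.map (fun p => FreeGroup.of p.1 ^ p.2)).prod (delta α) with hf
    have hm : magnus α ((((a, n) :: l).map (fun p => FreeGroup.of p.1 ^ p.2)).prod) (delta α) = (actE a ^ n) f := by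
      simp [hf, magnus]
    rw [hm]
    have hch : (((a, n) :: l).map Prod.fst).IsChain (· ≠ ·) := by
      rw [List.isChain_map]; exact h2
    have hhead : ∀ w : List α, (a :: w).IsChain (· ≠ ·) → w.head? ≠ some a := by
      intro w hw h
      rw [List.isChain_cons] at hw
      exact hw.1 a (by simp [h]) rfl
    constructor
    · rw [List.map_cons] at hch ⊢
      rw [(act_pow a n f).2 _ (hhead _ hch), i2 _ hch (by simp)]
      simpa using ⟨hn, i1⟩
    · intro v hv hlen
      by_cases hva : v.head? = some a
      · cases v with
        | nil => simp at hva
        | cons c w =>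
          simp at hva
          subst hva
          simp only [List.length_cons] at hlen
          rw [(act_pow c n f).2 _ (hhead _ hv), i2 _ hv (by simp; omega), i2 w hv.tail (by omega)]
          simp
      · simp only [List.length_cons] at hlen
        rw [(act_pow a n f).1 _ hva, i2 _ hv (by omega)]

theorem magnus_free {α : Type*} (x : FreeGroup α) (h : magnus α x (delta α) = delta α) : x = 1 := by
  obtain ⟨l, h1, h2, rfl⟩ := syllables x
  cases l with
  | nil => simp
  | cons p l =>
    have := (magnus_syll (p :: l) h1 h2).1
    rw [h] at this
    simp [delta] at this

theorem exists_left_order_free (α : Type*) : ∃ o : LinearOrder (FreeGroup α),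
    ∀ x y z : FreeGroup α, o.lt y z → o.lt (x * y) (x * z) := by
  classical
  have wf : WellFounded (fun u w : List α => u.length < w.length) := (measure List.length).wf
  have : IsWellFounded (List α) (fun u w : List α => u.length < w.length) := ⟨wf⟩
  obtain ⟨s, hs, hso⟩ := IsWellFounded.exists_well_order_ge (fun u w : List α => u.length < w.length)
  letI : LinearOrder (List α) := linearOrderOfSTO s
  haveI : WellFoundedLT (List α) := ⟨hso.wf⟩
  have hlt : ∀ (c : α) (w : List α), w < c :: w := fun c w => hs _ _ (by simp)
  -- the linear order on power series
  have hact : ∀ (a : α) (f g : List α → ℤ), toLex f < toLex g → toLex (act a f) < toLex (act a g) := by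
    rintro a f g ⟨w, hw, hfg⟩
    have aux : ∀ u, u < w → act a f u = act a g u := by
      intro u hu
      cases u with
      | nil => exact hw _ hu
      | cons c u =>
        have e1 : f (c :: u) = g (c :: u) := hw _ hu
        have e2 : f u = g u := hw _ ((hlt c u).trans hu)
        rw [act, act, e1, e2]
    refine ⟨w, aux, ?_⟩
    cases w with
    | nil => exact hfg
    | cons c w =>
      have e2 : f w = g w := hw _ (hlt c w)
      have e3 : f (c :: w) < g (c :: w) := hfg
      change act a f (c :: w) < act a g (c :: w)
      rw [act, act, e2]
      linarith
  have hinv : ∀ (a : α) (f g : List α → ℤ), toLex f < toLex g →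
      toLex ((actE a)⁻¹ f) < toLex ((actE a)⁻¹ g) := by
    intro a f g hfg
    rcases lt_trichotomy (toLex ((actE a)⁻¹ f)) (toLex ((actE a)⁻¹ g)) with h | h | h
    · exact h
    · have := (actE a)⁻¹.injective (toLex.injective h)
      rw [this] at hfg
      exact absurd hfg (lt_irrefl _)
    · have := hact a _ _ h
      have e : ∀ f, act a ((actE a)⁻¹ f) = f := fun f => (actE a).right_inv f
      rw [e, e] at this
      exact absurd hfg this.asymm
  have hmag : ∀ (x : FreeGroup α) (f g : List α → ℤ), toLex f < toLex g →
      toLex (magnus α x f) < toLex (magnus α x g) := by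
    intro x
    induction x using FreeGroup.induction_on with
    | C1 => intro f g h; simpa using h
    | of a => intro f g h; simpa [magnus, actE_apply] using hact a f g h
    | inv_of a _ => intro f g h; simpa [magnus] using hinv a f g h
    | mul x y hx hy =>
      intro f g h
      rw [map_mul, Equiv.Perm.mul_apply, Equiv.Perm.mul_apply]
      exact hx _ _ (hy _ _ h)
  have hinj : Function.Injective (fun x : FreeGroup α => toLex (magnus α x (delta α))) := by
    intro x y hxy
    have h : magnus α x (delta α) = magnus α y (delta α) := toLex.injective hxy
    have : magnus α (y⁻¹ * x) (delta α) = delta α := by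
      rw [map_mul, Equiv.Perm.mul_apply, h, ← Equiv.Perm.mul_apply, ← map_mul]
      simp
    have := magnus_free _ this
    exact (inv_mul_eq_one.1 this).symm
  refine ⟨LinearOrder.lift' _ hinj, ?_⟩
  intro x y z hyz
  change toLex (magnus α (x * y) (delta α)) < toLex (magnus α (x * z) (delta α))
  rw [map_mul, map_mul, Equiv.Perm.mul_apply, Equiv.Perm.mul_apply]
  exact hmag x _ _ hyz

theorem exists_left_order (F : Type*) [Group F] [IsFreeGroup F] : ∃ o : LinearOrder F,
    ∀ x y z : F, o.lt y z → o.lt (x * y) (x * z) := by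
  obtain ⟨o, ho⟩ := exists_left_order_free (IsFreeGroup.Generators F)
  refine ⟨@LinearOrder.lift' _ _ o (IsFreeGroup.toFreeGroup F) (MulEquiv.injective _), ?_⟩
  intro x y z h
  change o.lt (IsFreeGroup.toFreeGroup F (x * y)) (IsFreeGroup.toFreeGroup F (x * z))
  rw [map_mul, map_mul]
  exact ho _ _ _ h

end Order

section Tree

variable {F α : Type*} [Group F]

/-- Connectivity in the subgraph of the Cayley graph with edge set `S`. -/
def Conn (b : α → F) (S : Set (F × α)) : F → F → Prop :=
  Relation.EqvGen (fun x y => ∃ a, (x, a) ∈ S ∧ y = x * b a)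

theorem Conn.rfl' {b : α → F} {S : Set (F × α)} (x : F) : Conn b S x x := Relation.EqvGen.refl x

theorem Conn.symm {b : α → F} {S : Set (F × α)} {x y : F} (h : Conn b S x y) : Conn b S y x :=
  Relation.EqvGen.symm _ _ h

theorem Conn.trans {b : α → F} {S : Set (F × α)} {x y z : F} (h : Conn b S x y)
    (h' : Conn b S y z) : Conn b S x z :=
  Relation.EqvGen.trans _ _ _ h h'

theorem conn_edge {b : α → F} {S : Set (F × α)} {x : F} {a : α} (h : (x, a) ∈ S) :
    Conn b S x (x * b a) := Relation.EqvGen.rel _ _ ⟨a, h, rfl⟩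

theorem Conn.inv {b : α → F} {S : Set (F × α)} {T : Sort*} (f : F → T)
    (hf : ∀ x a, (x, a) ∈ S → f x = f (x * b a)) {x y : F} (h : Conn b S x y) : f x = f y := by
  induction h with
  | rel x y h => obtain ⟨a, h, rfl⟩ := h; exact hf x a h
  | refl x => rfl
  | symm x y _ ih => exact ih.symm
  | trans x y z _ _ ih ih' => exact ih.trans ih'

theorem Conn.map {b : α → F} {S S' : Set (F × α)} (g : F)
    (hS : ∀ x a, (x, a) ∈ S → (g * x, a) ∈ S') {x y : F} (h : Conn b S x y) :
    Conn b S' (g * x) (g * y) := by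
  induction h with
  | rel x y h => obtain ⟨a, h, rfl⟩ := h; rw [← mul_assoc]; exact conn_edge (hS x a h)
  | refl x => exact Conn.rfl' _
  | symm x y _ ih => exact ih.symm
  | trans x y z _ _ ih ih' => exact ih.trans ih'

theorem Conn.mono {b : α → F} {S S' : Set (F × α)} (hS : S ⊆ S') {x y : F} (h : Conn b S x y) :
    Conn b S' x y := by
  simpa using h.map 1 (S' := S') (fun x a hx => by simpa using hS hx)

theorem gen_induction {b : α → F} (gen : Subgroup.closure (Set.range b) = ⊤) {p : F → Prop} (x₀ : F)
    (h0 : p x₀) (h1 : ∀ x a, p x → p (x * b a)) (h2 : ∀ x a, p (x * b a) → p x) (x : F) : p x := by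
  have hx : x₀⁻¹ * x ∈ Subgroup.closure (Set.range b) := by rw [gen]; trivial
  have : ∀ y ∈ Subgroup.closure (Set.range b), p (x₀ * y) := by
    intro y hy
    induction hy using Subgroup.closure_induction_right with
    | one => simpa using h0
    | mul_right y _ z hz ih => 
      obtain ⟨a, rfl⟩ := hz
      rw [← mul_assoc]; exact h1 _ _ ih
    | mul_inv_cancel y _ z hz ih => 
      obtain ⟨a, rfl⟩ := hz
      rw [← mul_assoc]; apply h2 _ a; simpa using ih
  simpa using this _ hx

theorem conn_univ {b : α → F} (gen : Subgroup.closure (Set.range b) = ⊤) (x y : F) :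
    Conn b Set.univ x y := by
  refine gen_induction gen x (Conn.rfl' _) ?_ ?_ y
  · intro y a h; exact h.trans (conn_edge (Set.mem_univ _))
  · intro y a h; exact h.trans (conn_edge (Set.mem_univ _)).symm

/-- Existence of potentials: the Cayley graph is a tree. -/
def HasPot (b : α → F) : Prop := ∀ ω : F × α → ℚ, ∃ f : F → ℚ, f 1 = 0 ∧
  ∀ x a, f (x * b a) = f x + ω (x, a)

theorem not_conn {b : α → F} (pot : HasPot b) (e : F × α) :
    ¬ Conn b {e}ᶜ e.1 (e.1 * b e.2) := by
  classical
  intro h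
  obtain ⟨f, -, hf⟩ := pot (fun e' => if e' = e then 1 else 0)
  have := h.inv f (fun x a hx => by rw [hf]; simp at hx; simp [hx])
  rw [hf] at this
  simp at this

/-- Induced edges. -/
def EW (b : α → F) (W : Set F) : Set (F × α) := {e | e.1 ∈ W ∧ e.1 * b e.2 ∈ W}

def Comp (b : α → F) (S : Set (F × α)) (v : F) : Set F := {w | Conn b S v w}

theorem comp_subset_closed {b : α → F} {S : Set (F × α)} {v : F} (D : Set F) (hv : v ∈ D)
    (hD : ∀ x a, (x, a) ∈ S → (x ∈ D ↔ x * b a ∈ D)) : Comp b S v ⊆ D := by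
  intro w hw
  have := Conn.inv (fun x => x ∈ D) (fun x a h => propext (hD x a h)) hw
  simpa [← this] using hv

theorem comp_eq {b : α → F} {S : Set (F × α)} {v w : F} (h : Conn b S v w) :
    Comp b S v = Comp b S w :=
  Set.ext fun _ => ⟨fun h' => h.symm.trans h', fun h' => h.trans h'⟩

def tr (g : F) (e : F × α) : F × α := (g * e.1, e.2)

theorem tr_EW {b : α → F} {W W' : Set F} {g : F} (hW : ∀ x ∈ W, g * x ∈ W') {e : F × α}
    (he : e ∈ EW b W) : tr g e ∈ EW b W' :=
  ⟨hW _ he.1, by simpa [tr, mul_assoc] using hW _ he.2⟩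

theorem tr_inv_tr (g : F) (e : F × α) : tr g (tr g⁻¹ e) = e := by simp [tr]

theorem tr_tr_inv (g : F) (e : F × α) : tr g⁻¹ (tr g e) = e := by simp [tr]

variable [LinearOrder F] [LinearOrder α]

def ELt (b : α → F) (W : Set F) (e : F × α) : Set (F × α) := {e' | e' ∈ EW b W ∧ toLex e' < toLex e}

def ELe (b : α → F) (W : Set F) (e : F × α) : Set (F × α) := {e' | e' ∈ EW b W ∧ toLex e' ≤ toLex e}

theorem ELt_subset (b : α → F) (W : Set F) (e : F × α) : ELt b W e ⊆ ELe b W e :=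
  fun _ h => ⟨h.1, h.2.le⟩

theorem ELe_subset (b : α → F) (W : Set F) {e e' : F × α} (h : toLex e < toLex e') :
    ELe b W e ⊆ ELt b W e' := fun _ h' => ⟨h'.1, lt_of_le_of_lt h'.2 h⟩

theorem comp_ELe_sub {b : α → F} {W : Set F} {e : F × α} {v : F} (hv : v ∈ W) :
    Comp b (ELe b W e) v ⊆ W :=
  comp_subset_closed W hv fun x a h => by
    have := h.1; exact ⟨fun _ => this.2, fun _ => this.1⟩

/-- Bridges. -/
def Br (b : α → F) (W : Set F) (e : F × α) : Prop :=
  e ∈ EW b W ∧ (Comp b (ELt b W e) e.1).Infinite ∧ (Comp b (ELt b W e) (e.1 * b e.2)).Infinite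

def Alive (C : Set F) (v : F) : Prop := C.Finite ∧ ∀ w ∈ C, v ≤ w

theorem Alive.mono {C D : Set F} {v : F} (h : Alive D v) (hs : C ⊆ D) : Alive C v :=
  ⟨h.1.subset hs, fun w hw => h.2 w (hs hw)⟩

def Kills (b : α → F) (W : Set F) (e : F × α) (v : F) : Prop :=
  e ∈ EW b W ∧ v ∈ W ∧ Alive (Comp b (ELt b W e) v) v ∧ ¬ Alive (Comp b (ELe b W e) v) v

theorem Kills.unique_edge {b : α → F} {W : Set F} {e e' : F × α} {v : F}
    (h : Kills b W e v) (h' : Kills b W e' v) : e = e' := by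
  rcases lt_trichotomy (toLex e) (toLex e') with hl | hl | hl
  · exact absurd (h'.2.2.1.mono fun w hw => Conn.mono (ELe_subset b W hl) hw) h.2.2.2
  · exact toLex.injective hl
  · exact absurd (h.2.2.1.mono fun w hw => Conn.mono (ELe_subset b W hl) hw) h'.2.2.2

theorem mem_ELe {b : α → F} {W : Set F} {e e' : F × α} (h : e' ∈ ELe b W e) :
    e' ∈ ELt b W e ∨ e' = e := by
  rcases h.2.lt_or_eq with h' | h'
  · exact Or.inl ⟨h.1, h'⟩
  · exact Or.inr (toLex.injective h')

theorem comp_ELe_union {b : α → F} {W : Set F} {e : F × α} {v : F}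
    (hv : Conn b (ELt b W e) v e.1 ∨ Conn b (ELt b W e) v (e.1 * b e.2)) :
    Comp b (ELe b W e) v ⊆ Comp b (ELt b W e) e.1 ∪ Comp b (ELt b W e) (e.1 * b e.2) := by
  apply comp_subset_closed
  · rcases hv with h | h
    · exact Or.inl h.symm
    · exact Or.inr h.symm
  · intro x a h
    rcases mem_ELe h with h | h
    · have := conn_edge (b := b) h
      constructor
      · rintro (h | h)
        · exact Or.inl (h.trans this)
        · exact Or.inr (h.trans this)
      · rintro (h | h)
        · exact Or.inl (h.trans this.symm)
        · exact Or.inr (h.trans this.symm)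
    · subst h
      exact ⟨fun _ => Or.inr (Conn.rfl' _), fun _ => Or.inl (Conn.rfl' _)⟩

theorem Kills.conn {b : α → F} {W : Set F} {e : F × α} {v : F} (h : Kills b W e v) :
    Conn b (ELt b W e) v e.1 ∨ Conn b (ELt b W e) v (e.1 * b e.2) := by
  by_contra! hc
  refine h.2.2.2 (h.2.2.1.mono ?_)
  apply comp_subset_closed _ (Conn.rfl' _)
  intro x a hx
  rcases mem_ELe hx with hx | hx
  · have := conn_edge (b := b) hx
    exact ⟨fun h => Conn.trans h this, fun h => Conn.trans h this.symm⟩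
  · subst hx
    exact ⟨fun h => absurd h hc.1, fun h => absurd h hc.2⟩

theorem Kills.not_br {b : α → F} {W : Set F} {e : F × α} {v : F} (h : Kills b W e v) :
    ¬ Br b W e := by
  intro hb
  rcases h.conn with hc | hc
  · have := h.2.2.1.1
    rw [comp_eq hc] at this
    exact hb.2.1 this
  · have := h.2.2.1.1
    rw [comp_eq hc] at this
    exact hb.2.2 this

theorem Kills.unique_aux {b : α → F} {W : Set F} {e : F × α} {v v' : F}
    (h : Kills b W e v) (h' : Kills b W e v') (hc : Conn b (ELt b W e) v e.1)
    (hc' : Conn b (ELt b W e) v' (e.1 * b e.2)) : False := by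
  have a1 := h.2.2.1
  have a2 := h'.2.2.1
  rw [comp_eq hc] at a1
  rw [comp_eq hc'] at a2
  rcases le_total v v' with hl | hl
  · refine h.2.2.2 (Alive.mono ⟨a1.1.union a2.1, ?_⟩ (comp_ELe_union (Or.inl hc)))
    rintro w (hw | hw)
    · exact a1.2 w hw
    · exact hl.trans (a2.2 w hw)
  · refine h'.2.2.2 (Alive.mono ⟨a1.1.union a2.1, ?_⟩ (comp_ELe_union (Or.inr hc')))
    rintro w (hw | hw)
    · exact hl.trans (a1.2 w hw)
    · exact a2.2 w hw

theorem Kills.unique_vertex {b : α → F} {W : Set F} {e : F × α} {v v' : F}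
    (h : Kills b W e v) (h' : Kills b W e v') : v = v' := by
  have same : Conn b (ELt b W e) v v' → v = v' := fun hc =>
    le_antisymm (h.2.2.1.2 _ hc) (h'.2.2.1.2 _ hc.symm)
  rcases h.conn with hc | hc <;> rcases h'.conn with hc' | hc'
  · exact same (hc.trans hc'.symm)
  · exact (h.unique_aux h' hc hc').elim
  · exact (h'.unique_aux h hc' hc).elim
  · exact same (hc.trans hc'.symm)

theorem exists_kills_vertex {b : α → F} (pot : HasPot b) {W : Set F} {e : F × α} (he : e ∈ EW b W)
    (hb : ¬ Br b W e) : ∃ v, Kills b W e v := by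
  set p := e.1 with hp
  set q := e.1 * b e.2 with hq
  have hpq : Conn b (ELe b W e) p q := conn_edge (S := ELe b W e) ⟨he, le_refl _⟩
  have hne : ¬ Conn b (ELt b W e) p q := fun h => not_conn pot e
    (h.mono (fun e' he' => by rintro rfl; exact lt_irrefl _ he'.2))
  have hfin : (Comp b (ELt b W e) p).Finite ∨ (Comp b (ELt b W e) q).Finite := by
    by_contra! h; exact hb ⟨he, h.1, h.2⟩
  -- one of the two sides is killed
  have key : ∀ p q : F, p ∈ W → Conn b (ELe b W e) p q → ∀ v, Conn b (ELt b W e) p v →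
      Alive (Comp b (ELt b W e) p) v →
      ((Comp b (ELt b W e) q).Infinite ∨ ∃ w ∈ Comp b (ELt b W e) q, w < v) → Kills b W e v := by
    intro p q hpW hpq v hv hal hor
    refine ⟨he, ?_, ?_, ?_⟩
    · exact comp_ELe_sub hpW (hv.mono (ELt_subset b W e))
    · rwa [← comp_eq hv]
    · intro hal'
      have hvq : Conn b (ELe b W e) v q := (hv.symm.mono (ELt_subset b W e)).trans hpq
      rcases hor with h | ⟨w, hw, hwv⟩
      · exact h (hal'.1.subset fun w hw => hvq.trans (hw.mono (ELt_subset b W e)))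
      · exact absurd (hal'.2 w (hvq.trans (hw.mono (ELt_subset b W e)))) (not_le.2 hwv)
  have hmin : ∀ p : F, (Comp b (ELt b W e) p).Finite → ∃ v, Conn b (ELt b W e) p v ∧
      Alive (Comp b (ELt b W e) p) v := by
    intro p hf
    obtain ⟨v, hv, hm⟩ := Set.exists_min_image _ id hf ⟨p, Conn.rfl' p⟩
    exact ⟨v, hv, hf, hm⟩
  by_cases hP : (Comp b (ELt b W e) p).Finite
  · obtain ⟨v, hv, hva⟩ := hmin p hP
    by_cases hQ : (Comp b (ELt b W e) q).Finite
    · obtain ⟨w, hw, hwa⟩ := hmin q hQ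
      rcases lt_trichotomy v w with h | h | h
      · exact ⟨w, key q p he.2 hpq.symm w hw hwa (Or.inr ⟨v, hv, h⟩)⟩
      · subst h; exact (hne (hv.trans hw.symm)).elim
      · exact ⟨v, key p q he.1 hpq v hv hva (Or.inr ⟨w, hw, h⟩)⟩
    · exact ⟨v, key p q he.1 hpq v hv hva (Or.inl hQ)⟩
  · obtain ⟨w, hw, hwa⟩ := hmin q (hfin.resolve_left hP)
    exact ⟨w, key q p he.2 hpq.symm w hw hwa (Or.inl hP)⟩

/-! Equivariance -/

theorem tr_lt {g : F} (hord : ∀ x y z : F, y < z → x * y < x * z) {e e' : F × α} :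
    toLex (tr g e) < toLex (tr g e') ↔ toLex e < toLex e' := by
  have h : ∀ (g : F) (e e' : F × α), toLex e < toLex e' → toLex (tr g e) < toLex (tr g e') := by
    rintro g ⟨x, a⟩ ⟨y, c⟩ h
    rw [Prod.Lex.toLex_lt_toLex] at h ⊢
    rcases h with h | ⟨h, h'⟩
    · exact Or.inl (hord _ _ _ h)
    · exact Or.inr ⟨congrArg (g * ·) h, h'⟩
  refine ⟨fun h' => ?_, h g e e'⟩
  simpa [tr] using h g⁻¹ _ _ h'

theorem tr_le {g : F} (hord : ∀ x y z : F, y < z → x * y < x * z) {e e' : F × α} :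
    toLex (tr g e) ≤ toLex (tr g e') ↔ toLex e ≤ toLex e' := by
  rw [← not_lt, ← not_lt, tr_lt hord]

theorem tr_ELt {b : α → F} (hord : ∀ x y z : F, y < z → x * y < x * z) {W W' : Set F} {g : F}
    (hW : ∀ x ∈ W, g * x ∈ W') {e e' : F × α}
    (he : e' ∈ ELt b W e) : tr g e' ∈ ELt b W' (tr g e) :=
  ⟨tr_EW hW he.1, (tr_lt hord).2 he.2⟩

theorem tr_ELe {b : α → F} (hord : ∀ x y z : F, y < z → x * y < x * z) {W W' : Set F} {g : F}
    (hW : ∀ x ∈ W, g * x ∈ W') {e e' : F × α}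
    (he : e' ∈ ELe b W e) : tr g e' ∈ ELe b W' (tr g e) :=
  ⟨tr_EW hW he.1, (tr_le hord).2 he.2⟩

theorem Br.tr {b : α → F} (hord : ∀ x y z : F, y < z → x * y < x * z) {W W' : Set F} {g : F}
    (hW : ∀ x ∈ W, g * x ∈ W') {e : F × α} (h : Br b W e) : Br b W' (tr g e) := by
  have key : ∀ p, (Comp b (ELt b W e) p).Infinite → (Comp b (ELt b W' (SHN.tr g e)) (g * p)).Infinite := by
    intro p hp
    refine (hp.image (f := (g * ·)) (fun x _ y _ h => mul_left_cancel h)).mono ?_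
    rintro _ ⟨w, hw, rfl⟩
    exact Conn.map g (fun x a hx => tr_ELt hord hW hx) hw
  refine ⟨tr_EW hW h.1, key _ h.2.1, ?_⟩
  have := key _ h.2.2
  simpa [SHN.tr, mul_assoc] using this

theorem Alive.tr {b : α → F} (hord : ∀ x y z : F, y < z → x * y < x * z) 
    {S S' : Set (F × α)} {g : F} {v : F} (hS : ∀ e ∈ S', tr g⁻¹ e ∈ S)
    (h : Alive (Comp b S v) v) : Alive (Comp b S' (g * v)) (g * v) := by
  have hsub : Comp b S' (g * v) ⊆ (g * ·) '' Comp b S v := by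
    intro w hw
    refine ⟨g⁻¹ * w, ?_, by simp⟩
    have := Conn.map (S' := S) g⁻¹ (fun x a hx => hS _ hx) hw
    change Conn b S v (g⁻¹ * w)
    simpa using this
  refine ⟨(h.1.image _).subset hsub, ?_⟩
  intro w hw
  obtain ⟨u, hu, rfl⟩ := hsub hw
  rcases (h.2 u hu).lt_or_eq with h | h
  · exact (hord _ _ _ h).le
  · rw [h]

theorem Kills.tr {b : α → F} (hord : ∀ x y z : F, y < z → x * y < x * z) {W : Set F} {g : F}
    (hW : ∀ x, g * x ∈ W ↔ x ∈ W) {e : F × α} {v : F} (h : Kills b W e v) :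
    Kills b W (tr g e) (g * v) := by
  have hW1 : ∀ x ∈ W, g * x ∈ W := fun x hx => (hW x).2 hx
  have hW2 : ∀ x ∈ W, g⁻¹ * x ∈ W := fun x hx => by rw [← hW]; simpa using hx
  refine ⟨tr_EW hW1 h.1, hW1 _ h.2.1, ?_, fun hal => h.2.2.2 ?_⟩
  · refine Alive.tr hord (fun e' he' => ?_) h.2.2.1
    have := tr_ELt hord hW2 he'
    rwa [tr_tr_inv] at this
  · have := Alive.tr (S' := ELe b W e) (g := g⁻¹) hord (fun e' he' => ?_) hal
    · simpa using this
    · have := tr_ELe hord hW1 he'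
      simpa using this

end Tree

section Count

variable {F α : Type*} [Group F]

/-- The quotient `H \ F`. -/
abbrev Q (H : Subgroup F) : Type _ := Quotient (QuotientGroup.rightRel H)

abbrev cls (H : Subgroup F) (x : F) : Q H := Quotient.mk (QuotientGroup.rightRel H) x

theorem cls_eq {H : Subgroup F} {x y : F} : cls H x = cls H y ↔ y * x⁻¹ ∈ H := by
  rw [Quotient.eq]
  exact QuotientGroup.rightRel_apply

theorem cls_eq' {H : Subgroup F} {x y : F} : cls H x = cls H y ↔ ∃ h ∈ H, y = h * x := by
  rw [cls_eq]
  constructor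
  · intro h; exact ⟨_, h, by simp⟩
  · rintro ⟨h, hh, rfl⟩; simpa using hh

theorem cls_out {H : Subgroup F} (q : Q H) : cls H q.out = q := Quotient.out_eq q

theorem out_cls (H : Subgroup F) (x : F) : ∃ h ∈ H, (cls H x).out = h * x :=
  cls_eq'.1 (cls_out (cls H x)).symm

def Vb (H : Subgroup F) (W : Set F) : Set (Q H) := {q | q.out ∈ W}

def Eb (b : α → F) (H : Subgroup F) (W : Set F) : Set (Q H × α) := {p | (p.1.out, p.2) ∈ EW b W}

structure Good (b : α → F) (H : Subgroup F) (W : Set F) : Prop where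
  one : 1 ∈ W
  inv : ∀ h ∈ H, ∀ x, h * x ∈ W ↔ x ∈ W
  conn : ∀ x ∈ W, ∀ y ∈ W, Conn b (EW b W) x y
  fin : (Vb H W).Finite

theorem Good.cls_mem {b : α → F} {H : Subgroup F} {W : Set F} (hW : Good b H W) {x : F} :
    cls H x ∈ Vb H W ↔ x ∈ W := by
  obtain ⟨h, hh, he⟩ := out_cls H x
  change (cls H x).out ∈ W ↔ _
  rw [he]; exact hW.inv h hh x

theorem Good.cls_mem_edge {b : α → F} {H : Subgroup F} {W : Set F} (hW : Good b H W) {x : F} {a : α} :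
    (cls H x, a) ∈ Eb b H W ↔ (x, a) ∈ EW b W := by
  obtain ⟨h, hh, he⟩ := out_cls H x
  change ((cls H x).out ∈ W ∧ (cls H x).out * b a ∈ W) ↔ (x ∈ W ∧ x * b a ∈ W)
  rw [he, hW.inv h hh x, mul_assoc, hW.inv h hh]

variable [LinearOrder F] [LinearOrder α]

def Bb (b : α → F) (H : Subgroup F) (W : Set F) : Set (Q H × α) := {p | Br b W (p.1.out, p.2)}

theorem not_shift {b : α → F} (hord : ∀ x y z : F, y < z → x * y < x * z) {W : Set F} {h : F}
    (hW : ∀ x ∈ W, h * x ∈ W) {e : F × α} {v w : F} (hf : (Comp b (ELe b W e) v).Finite)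
    (hw : w ∈ Comp b (ELe b W e) v) (hhw : h * w ∈ Comp b (ELe b W e) v)
    (hlt : toLex (tr h e) < toLex e) : False := by
  have step : ∀ u ∈ Comp b (ELe b W e) v, h * u ∈ Comp b (ELe b W e) v := by
    intro u hu
    have h1 : Conn b (ELe b W e) w u := Conn.trans (Conn.symm hw) hu
    have h2 : Conn b (ELe b W (tr h e)) (h * w) (h * u) := h1.map h (fun x a hx => tr_ELe hord hW hx)
    have h3 : Conn b (ELe b W e) (h * w) (h * u) :=
      h2.mono ((ELe_subset b W hlt).trans (ELt_subset b W e))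
    exact Conn.trans hhw h3
  have hn : ∀ n : ℕ, h ^ n * w ∈ Comp b (ELe b W e) v := by
    intro n
    induction n with
    | zero => simpa using hw
    | succ n ih => rw [pow_succ', mul_assoc]; exact step _ ih
  have hanti : StrictAnti (fun n : ℕ => toLex (tr (h ^ n) e)) := by
    apply strictAnti_nat_of_succ_lt
    intro n
    have : tr (h ^ (n + 1)) e = tr (h ^ n) (tr h e) := by simp [tr, pow_succ, mul_assoc]
    rw [this, tr_lt hord]; exact hlt
  refine Set.infinite_of_injective_forall_mem (f := fun n : ℕ => h ^ n * w) ?_ hn hf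
  intro m n hmn
  have : h ^ m = h ^ n := mul_right_cancel hmn
  apply hanti.injective
  simp only [this]

theorem alive_bound {b : α → F} (hord : ∀ x y z : F, y < z → x * y < x * z) {W : Set F}
    {H : Subgroup F} (hW : Good b H W) {e : F × α} {v : F} (hv : v ∈ W)
    (hf : (Comp b (ELe b W e) v).Finite) : (Comp b (ELe b W e) v).ncard ≤ (Vb H W).ncard := by
  apply Set.ncard_le_ncard_of_injOn (cls H) _ _ hW.fin
  · intro w hw
    exact hW.cls_mem.2 (comp_ELe_sub hv hw)
  · intro w hw w' hw' heq
    obtain ⟨h, hh, rfl⟩ := cls_eq'.1 heq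
    have hWi : ∀ h ∈ H, ∀ x ∈ W, h * x ∈ W := fun h hh x hx => (hW.inv h hh x).2 hx
    rcases lt_trichotomy (toLex (tr h e)) (toLex e) with hl | hl | hl
    · exact (not_shift hord (hWi h hh) hf hw hw' hl).elim
    · have := congrArg Prod.fst (toLex.injective hl)
      have : h = 1 := by simpa [tr] using this
      simp [this]
    · refine (not_shift hord (hWi h⁻¹ (H.inv_mem hh)) hf hw' (by simpa using hw) ?_).elim
      have := (tr_lt (g := h⁻¹) hord).2 hl
      rwa [tr_tr_inv] at this

theorem exists_kills_edge {b : α → F} (hord : ∀ x y z : F, y < z → x * y < x * z) {W : Set F}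
    {H : Subgroup F} (hW : Good b H W) (hE : (Eb b H W).Finite) (hinf : W.Infinite) {v : F}
    (hv : v ∈ W) : ∃ e, Kills b W e v := by
  classical
  let fam : Set (Set F) := {C | (C = {v} ∨ ∃ e, C = Comp b (ELe b W e) v) ∧ Alive C v}
  obtain ⟨C, hC, hmax⟩ : ∃ C ∈ fam, ∀ C' ∈ fam, C'.ncard ≤ C.ncard := by
    have hbdd : BddAbove (Set.ncard '' fam) := by
      refine ⟨(Vb H W).ncard + 1, ?_⟩
      rintro _ ⟨C, ⟨rfl | ⟨e, rfl⟩, hal⟩, rfl⟩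
      · simp
      · exact (alive_bound hord hW hv hal.1).trans (Nat.le_succ _)
    have hne : (Set.ncard '' fam).Nonempty :=
      ⟨_, {v}, ⟨Or.inl rfl, Set.finite_singleton _, by simp⟩, rfl⟩
    obtain ⟨C, hC, hs⟩ := Nat.sSup_mem hne hbdd
    refine ⟨C, hC, fun C' hC' => ?_⟩
    rw [hs]
    exact le_csSup hbdd ⟨C', hC', rfl⟩
  have hvC : v ∈ C := by
    rcases hC.1 with rfl | ⟨e, rfl⟩
    · rfl
    · exact Conn.rfl' v
  have hCf : C.Finite := hC.2.1
  let Bd : Set (F × α) := {e | e ∈ EW b W ∧ ¬ (e.1 ∈ C ↔ e.1 * b e.2 ∈ C)}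
  have hBdf : Bd.Finite := by
    have hA : (Prod.snd '' Eb b H W).Finite := hE.image _
    refine ((hCf.prod hA).union ((hCf.prod hA).image (fun p => (p.1 * (b p.2)⁻¹, p.2)))).subset ?_
    rintro ⟨x, a⟩ ⟨he, hx⟩
    have ha : a ∈ Prod.snd '' Eb b H W := ⟨(cls H x, a), hW.cls_mem_edge.2 he, rfl⟩
    by_cases hxC : x ∈ C
    · exact Or.inl ⟨hxC, ha⟩
    · right
      have : x * b a ∈ C := by simp only [hxC, false_iff, not_not] at hx; exact hx
      exact ⟨(x * b a, a), ⟨this, ha⟩, by simp⟩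
  have hBdne : Bd.Nonempty := by
    by_contra hne
    rw [Set.not_nonempty_iff_eq_empty] at hne
    apply hinf
    refine hCf.subset fun w hw => ?_
    refine comp_subset_closed (b := b) (S := EW b W) C hvC ?_ (hW.conn v hv w hw)
    intro x a hx
    by_contra hc
    have : (x, a) ∈ Bd := ⟨hx, hc⟩
    rw [hne] at this
    exact this
  obtain ⟨e, he, hmin⟩ := Set.exists_min_image Bd toLex hBdf hBdne
  have hsub : C ⊆ Comp b (ELe b W e) v := by
    rcases hC.1 with h | ⟨e0, h⟩
    · rw [h]; rintro _ rfl; exact Conn.rfl' _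
    · have hlt : toLex e0 < toLex e := by
        by_contra hc
        have hmem : (e.1, e.2) ∈ ELe b W e0 := ⟨he.1, not_lt.1 hc⟩
        have hc := conn_edge (b := b) hmem
        apply he.2
        rw [h]
        exact ⟨fun h => Conn.trans h hc, fun h => Conn.trans h hc.symm⟩
      rw [h]
      intro w hw
      exact Conn.mono ((ELe_subset b W hlt).trans (ELt_subset b W e)) hw
  refine ⟨e, he.1, hv, ?_, ?_⟩
  · refine hC.2.mono (comp_subset_closed C hvC ?_)
    intro x a hx
    by_contra hc
    exact absurd hx.2 (not_lt.2 (hmin (x, a) ⟨hx.1, hc⟩))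
  · intro hal
    have hle := hmax _ ⟨Or.inr ⟨e, rfl⟩, hal⟩
    have hlt : C.ncard < (Comp b (ELe b W e) v).ncard := by
      refine Set.ncard_lt_ncard (hsub.ssubset_of_ne ?_) hal.1
      intro heq
      have hmem : (e.1, e.2) ∈ ELe b W e := ⟨he.1, le_refl _⟩
      have hc := conn_edge (b := b) hmem
      apply he.2
      rw [heq]
      exact ⟨fun h => Conn.trans h hc, fun h => Conn.trans h hc.symm⟩
    omega

theorem count_bridges {b : α → F} (pot : HasPot b) (hord : ∀ x y z : F, y < z → x * y < x * z)
    {W : Set F} {H : Subgroup F} (hW : Good b H W) (hE : (Eb b H W).Finite) (hinf : W.Infinite) :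
    (Bb b H W).ncard + (Vb H W).ncard = (Eb b H W).ncard := by
  have hsub : Bb b H W ⊆ Eb b H W := fun p hp => hp.1
  have key : (Eb b H W \ Bb b H W).ncard = (Vb H W).ncard := by
    apply le_antisymm
    · have hex : ∀ p ∈ Eb b H W \ Bb b H W, ∃ v, Kills b W (p.1.out, p.2) v := fun p hp =>
        exists_kills_vertex pot hp.1 hp.2
      choose! g hg using hex
      apply Set.ncard_le_ncard_of_injOn (fun p => cls H (g p)) _ _ hW.fin
      · intro p hp
        exact hW.cls_mem.2 (hg p hp).2.1
      · intro p hp p' hp' heq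
        obtain ⟨h, hh, he⟩ := cls_eq'.1 heq
        have h1 := (hg p hp).tr hord (hW.inv h hh)
        rw [← he] at h1
        have h2 := h1.unique_edge (hg p' hp')
        rw [tr, Prod.mk.injEq] at h2
        refine Prod.ext ?_ h2.2
        rw [← cls_out p.1, ← cls_out p'.1]
        exact cls_eq'.2 ⟨h, hh, h2.1.symm⟩
    · have hex : ∀ q ∈ Vb H W, ∃ e, Kills b W e q.out := fun q hq =>
        exists_kills_edge hord hW hE hinf hq
      haveI : Nonempty (F × α) := (exists_kills_edge hord hW hE hinf hW.one).nonempty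
      choose! f hf using hex
      apply Set.ncard_le_ncard_of_injOn (fun q => (cls H (f q).1, (f q).2)) _ _ hE.sdiff
      · intro q hq
        refine ⟨hW.cls_mem_edge.2 (hf q hq).1, ?_⟩
        obtain ⟨h, hh, he⟩ := out_cls H (f q).1
        have := ((hf q hq).tr hord (hW.inv h hh)).not_br
        change ¬ Br b W ((cls H (f q).1).out, (f q).2)
        rw [he]
        exact this
      · intro q hq q' hq' heq
        rw [Prod.mk.injEq] at heq
        obtain ⟨h, hh, he⟩ := cls_eq'.1 heq.1
        have h1 := (hf q hq).tr hord (hW.inv h hh)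
        have h3 : tr h (f q) = f q' := Prod.ext he.symm heq.2
        rw [h3] at h1
        have h2 := h1.unique_vertex (hf q' hq')
        rw [← cls_out q, ← cls_out q']
        exact cls_eq'.2 ⟨h, hh, h2.symm⟩
  rw [← key, add_comm]
  exact Set.ncard_sdiff_add_ncard_of_subset hsub hE

end Count

section Euler

variable {F α : Type*} [Group F]

theorem agree {b : α → F} {W : Set F} (hc : ∀ x ∈ W, ∀ y ∈ W, Conn b (EW b W) x y) (f f' : F → ℚ)
    (h : ∀ x a, (x, a) ∈ EW b W → f (x * b a) - f x = f' (x * b a) - f' x) {x y : F} (hx : x ∈ W)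
    (hy : y ∈ W) : f x - f y = f' x - f' y := by
  have := (hc x hx y hy).inv (fun z => f z - f' z) (fun z a hz => by have := h z a hz; linarith)
  linarith

theorem agree_univ {b : α → F} (gen : Subgroup.closure (Set.range b) = ⊤) (f f' : F → ℚ)
    (h : ∀ x a, f (x * b a) - f x = f' (x * b a) - f' x) (x y : F) : f x - f y = f' x - f' y :=
  agree (W := Set.univ) (b := b)
    (fun x _ y _ => (conn_univ gen x y).mono
      (fun e _ => (⟨trivial, trivial⟩ : e ∈ EW b Set.univ))) f f'
    (fun x a _ => h x a) trivial trivial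

/-- The potential as a linear map. -/
noncomputable def potL {b : α → F} (gen : Subgroup.closure (Set.range b) = ⊤) (pot : HasPot b) :
    (F × α → ℚ) →ₗ[ℚ] (F → ℚ) where
  toFun ω := (pot ω).choose
  map_add' ω ω' := by
    funext x
    have h := agree_univ gen (pot (ω + ω')).choose ((pot ω).choose + (pot ω').choose) (fun x a => by
      rw [(pot (ω + ω')).choose_spec.2, Pi.add_apply, Pi.add_apply, (pot ω).choose_spec.2,
        (pot ω').choose_spec.2, Pi.add_apply]
      ring) x 1
    rw [Pi.add_apply, Pi.add_apply, (pot (ω + ω')).choose_spec.1, (pot ω).choose_spec.1,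
        (pot ω').choose_spec.1] at h
    rw [Pi.add_apply]
    linarith
  map_smul' c ω := by
    funext x
    have h := agree_univ gen (pot (c • ω)).choose (c • (pot ω).choose) (fun x a => by
      rw [(pot (c • ω)).choose_spec.2, Pi.smul_apply, Pi.smul_apply, (pot ω).choose_spec.2,
        Pi.smul_apply, smul_eq_mul, smul_eq_mul, smul_eq_mul]
      ring) x 1
    rw [Pi.smul_apply, Pi.smul_apply, (pot (c • ω)).choose_spec.1, (pot ω).choose_spec.1] at h
    simpa using h

theorem potL_one {b : α → F} (gen : Subgroup.closure (Set.range b) = ⊤) (pot : HasPot b)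
    (ω : F × α → ℚ) : potL gen pot ω 1 = 0 := (pot ω).choose_spec.1

theorem potL_edge {b : α → F} (gen : Subgroup.closure (Set.range b) = ⊤) (pot : HasPot b)
    (ω : F × α → ℚ) (x : F) (a : α) : potL gen pot ω (x * b a) = potL gen pot ω x + ω (x, a) :=
  (pot ω).choose_spec.2 x a

open Classical in
/-- Extension by zero of a function on the edges of the quotient graph. -/
noncomputable def extL (b : α → F) (H : Subgroup F) (W : Set F) :
    (Eb b H W → ℚ) →ₗ[ℚ] (F × α → ℚ) where
  toFun ω e := if h : (cls H e.1, e.2) ∈ Eb b H W then ω ⟨_, h⟩ else 0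
  map_add' ω ω' := by
    funext e
    by_cases h : (cls H e.1, e.2) ∈ Eb b H W <;> simp [h]
  map_smul' c ω := by
    funext e
    by_cases h : (cls H e.1, e.2) ∈ Eb b H W <;> simp [h]

theorem extL_apply {b : α → F} {H : Subgroup F} {W : Set F} (ω : Eb b H W → ℚ) {x : F} {a : α}
    (p : Eb b H W) (h1 : p.1.1 = cls H x) (h2 : p.1.2 = a) : extL b H W ω (x, a) = ω p := by
  obtain ⟨⟨q, c⟩, hp⟩ := p
  simp only at h1 h2
  subst h1 h2
  simp [extL, hp]

theorem extL_shift {b : α → F} {H : Subgroup F} {W : Set F} (ω : Eb b H W → ℚ) {h x : F} {a : α}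
    (hh : h ∈ H) : extL b H W ω (h * x, a) = extL b H W ω (x, a) := by
  have : cls H (h * x) = cls H x := (cls_eq'.2 ⟨h, hh, rfl⟩).symm
  by_cases hp : (cls H x, a) ∈ Eb b H W
  · rw [extL_apply ω ⟨_, hp⟩ rfl rfl, extL_apply ω ⟨_, hp⟩ this.symm rfl]
  · have hp' : (cls H (h * x), a) ∉ Eb b H W := by rwa [this]
    have e1 : extL b H W ω (h * x, a) = 0 := dif_neg hp'
    have e2 : extL b H W ω (x, a) = 0 := dif_neg hp
    rw [e1, e2]

theorem cls_mul {H : Subgroup F} (x y : F) : cls H ((cls H x).out * y) = cls H (x * y) := by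
  obtain ⟨h, hh, he⟩ := out_cls H x
  rw [he, mul_assoc]
  exact (cls_eq'.2 ⟨h, hh, rfl⟩).symm

/-- The coboundary of the quotient graph. -/
noncomputable def dL {b : α → F} {H : Subgroup F} {W : Set F} (hW : Good b H W) :
    (Vb H W → ℚ) →ₗ[ℚ] (Eb b H W → ℚ) where
  toFun g p := g ⟨cls H (p.1.1.out * b p.1.2), hW.cls_mem.2 p.2.2⟩ - g ⟨p.1.1, p.2.1⟩
  map_add' g g' := by funext p; simp; ring
  map_smul' c g := by funext p; simp; ring

theorem finite_of_fun (E : Type*) [Module.Finite ℚ (E → ℚ)] : Finite E := by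
  classical
  have := Pi.linearIndependent_single_one E ℚ
  exact this.finite

theorem euler {b : α → F} (gen : Subgroup.closure (Set.range b) = ⊤) (pot : HasPot b)
    {H : Subgroup F} {W : Set F} (hW : Good b H W) {r : ℕ} (e : FreeGroup (Fin r) ≃* H) :
    (Eb b H W).Finite ∧ (Eb b H W).ncard + 1 = (Vb H W).ncard + r := by
  classical
  haveI : Finite (Vb H W) := hW.fin
  haveI : Fintype (Vb H W) := Fintype.ofFinite _
  let Ψ : (Eb b H W → ℚ) →ₗ[ℚ] (Fin r → ℚ) :=
    LinearMap.pi fun i => (LinearMap.proj ((e (FreeGroup.of i) : H) : F)) ∘ₗ potL gen pot ∘ₗ extL b H W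
  have hΨ : ∀ ω i, Ψ ω i = potL gen pot (extL b H W ω) (e (FreeGroup.of i) : H) := fun ω i => rfl
  have hHW : ∀ h ∈ H, h ∈ W := fun h hh => by simpa using (hW.inv h hh 1).2 hW.one
  have hone : cls H (1 : F) ∈ Vb H W := hW.cls_mem.2 hW.one
  -- kernel of Ψ
  have hker : LinearMap.ker Ψ = LinearMap.range (dL hW) := by
    ext ω
    rw [LinearMap.mem_ker, LinearMap.mem_range]
    constructor
    · intro h0
      set f := potL gen pot (extL b H W ω) with hf
      have hadd : ∀ h ∈ H, ∀ x, f (h * x) = f h + f x := by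
        intro h hh x
        have := agree_univ gen (fun x => f (h * x)) f (fun x a => by
          simp only [hf, ← mul_assoc]
          rw [potL_edge, potL_edge, extL_shift ω hh]
          ring) x 1
        simp only [mul_one] at this
        rw [hf, potL_one, ← hf] at this
        linarith
      let φ : FreeGroup (Fin r) →* Multiplicative ℚ :=
        { toFun := fun y => Multiplicative.ofAdd (f (e y : H))
          map_one' := by simp [hf, potL_one]
          map_mul' := by
            intro y z
            rw [map_mul, Subgroup.coe_mul, hadd _ (e y).2, ofAdd_add] }
      have hφ : φ = 1 := by
        apply FreeGroup.ext_hom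
        intro i
        change Multiplicative.ofAdd (f (e (FreeGroup.of i) : H)) = 1
        have h : f (e (FreeGroup.of i) : H) = 0 := congrFun h0 i
        rw [h]; rfl
      have hz : ∀ h ∈ H, f h = 0 := by
        intro h hh
        have := congrArg (fun ψ => ψ (e.symm ⟨h, hh⟩)) hφ
        change Multiplicative.ofAdd (f (e (e.symm ⟨h, hh⟩) : H)) = 1 at this
        simpa using this
      have hout : ∀ x, f (cls H x).out = f x := by
        intro x
        obtain ⟨h, hh, he⟩ := out_cls H x
        rw [he, hadd h hh, hz h hh, zero_add]
      refine ⟨fun q => f q.1.out, ?_⟩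
      funext p
      change f (cls H (p.1.1.out * b p.1.2)).out - f p.1.1.out = ω p
      rw [hout, hf, potL_edge, extL_apply ω p (cls_out _).symm rfl]
      ring
    · rintro ⟨g, rfl⟩
      let G : F → ℚ := fun x => if h : cls H x ∈ Vb H W then g ⟨_, h⟩ else 0
      have hG : ∀ (x : F) (q : Vb H W), q.1 = cls H x → G x = g q := by
        rintro x ⟨q, hq⟩ rfl
        simp [G, hq]
      funext i
      rw [hΨ]
      have := agree hW.conn (potL gen pot (extL b H W (dL hW g))) G (fun x a hx => by
        rw [potL_edge, extL_apply _ ⟨(cls H x, a), hW.cls_mem_edge.2 hx⟩ rfl rfl]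
        change _ + (g _ - g _) - _ = _
        rw [hG (x * b a) ⟨cls H ((cls H x).out * b a), by
          rw [cls_mul]; exact hW.cls_mem.2 hx.2⟩ (cls_mul x (b a)), 
          hG x ⟨cls H x, hW.cls_mem.2 hx.1⟩ rfl]
        ring) (hHW _ (e (FreeGroup.of i)).2) hW.one
      rw [potL_one] at this
      rw [hG 1 ⟨cls H 1, hone⟩ rfl, hG (e (FreeGroup.of i) : H) ⟨cls H 1, hone⟩
        (cls_eq'.2 ⟨_, (e (FreeGroup.of i)).2, by simp⟩)] at this
      simpa using this
  have hsurj : LinearMap.range Ψ = ⊤ := by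
    rw [LinearMap.range_eq_top]
    intro c
    let φ : FreeGroup (Fin r) →* Multiplicative ℚ := FreeGroup.lift fun i => Multiplicative.ofAdd (c i)
    have hm : ∀ x : F, x * ((cls H x).out)⁻¹ ∈ H := fun x => cls_eq.1 (cls_out (cls H x))
    let f : F → ℚ := fun x => Multiplicative.toAdd (φ (e.symm ⟨_, hm x⟩))
    have hf : ∀ (h : H) (x : F), f (h * x) = Multiplicative.toAdd (φ (e.symm h)) + f x := by
      intro h x
      have h1 : cls H ((h : F) * x) = cls H x := (cls_eq'.2 ⟨(h : F), h.2, rfl⟩).symm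
      have h2 : (⟨_, hm (h * x)⟩ : H) = h * ⟨_, hm x⟩ := by
        apply Subtype.ext
        simp [h1, mul_assoc]
      simp only [f]
      rw [h2, map_mul, map_mul, toAdd_mul]
    refine ⟨fun p => f (p.1.1.out * b p.1.2) - f p.1.1.out, ?_⟩
    funext i
    rw [hΨ]
    have := agree hW.conn (potL gen pot (extL b H W
      (fun p => f (p.1.1.out * b p.1.2) - f p.1.1.out))) f (fun x a hx => by
        rw [potL_edge, extL_apply _ ⟨(cls H x, a), hW.cls_mem_edge.2 hx⟩ rfl rfl]
        simp only
        obtain ⟨h, hh, he⟩ := out_cls H x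
        have e1 := hf ⟨h, hh⟩ x
        have e2 := hf ⟨h, hh⟩ (x * b a)
        simp only at e1 e2
        rw [he, mul_assoc, e1, e2]
        ring) (hHW _ (e (FreeGroup.of i)).2) hW.one
    have e3 := hf (e (FreeGroup.of i)) 1
    rw [potL_one] at this
    simp only [mul_one, MulEquiv.symm_apply_apply] at e3
    rw [e3] at this
    have e4 : Multiplicative.toAdd (φ (FreeGroup.of i)) = c i := by simp [φ]
    rw [e4] at this
    linarith
  have hkerd : LinearMap.ker (dL hW) = Submodule.span ℚ {fun _ => 1} := by
    ext g
    rw [LinearMap.mem_ker, Submodule.mem_span_singleton]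
    constructor
    · intro h0
      let G : F → ℚ := fun x => if h : cls H x ∈ Vb H W then g ⟨_, h⟩ else 0
      have hG : ∀ (x : F) (q : Vb H W), q.1 = cls H x → G x = g q := by
        rintro x ⟨q, hq⟩ rfl
        simp [G, hq]
      refine ⟨g ⟨_, hone⟩, ?_⟩
      funext q
      have := (hW.conn 1 hW.one q.1.out q.2).inv G (fun x a hx => by
        have := congrFun h0 ⟨(cls H x, a), hW.cls_mem_edge.2 hx⟩
        change g _ - g _ = 0 at this
        rw [hG (x * b a) ⟨cls H ((cls H x).out * b a), by
          rw [cls_mul]; exact hW.cls_mem.2 hx.2⟩ (cls_mul x (b a)), 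
          hG x ⟨cls H x, hW.cls_mem.2 hx.1⟩ rfl]
        linarith)
      rw [hG 1 ⟨cls H 1, hone⟩ rfl, hG q.1.out q (cls_out _).symm] at this
      simpa using this
    · rintro ⟨c, rfl⟩
      funext p
      change (_ : ℚ) - _ = 0
      simp
  have h1 := LinearMap.finrank_range_add_finrank_ker (dL hW)
  have hnz : (fun _ => 1 : Vb H W → ℚ) ≠ 0 := fun h => by
    have := congrFun h ⟨_, hone⟩
    simp at this
  rw [hkerd, finrank_span_singleton hnz, Module.finrank_fintype_fun_eq_card] at h1
  haveI : Module.Finite ℚ (LinearMap.ker Ψ) := by rw [hker]; infer_instance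
  haveI : Module.Finite ℚ ((Eb b H W → ℚ) ⧸ LinearMap.ker Ψ) :=
    Module.Finite.equiv Ψ.quotKerEquivRange.symm
  haveI : Module.Finite ℚ (Eb b H W → ℚ) := Module.Finite.of_submodule_quotient (LinearMap.ker Ψ)
  haveI : Finite (Eb b H W) := finite_of_fun _
  haveI : Fintype (Eb b H W) := Fintype.ofFinite _
  have h2 := LinearMap.finrank_range_add_finrank_ker Ψ
  rw [hsurj, hker, finrank_top, Module.finrank_fintype_fun_eq_card,
    Module.finrank_fintype_fun_eq_card, Fintype.card_fin] at h2
  refine ⟨Set.toFinite _, ?_⟩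
  rw [← Nat.card_coe_set_eq, ← Nat.card_coe_set_eq, Nat.card_eq_fintype_card,
    Nat.card_eq_fintype_card]
  omega

end Euler

section Final

variable {F α : Type*} [Group F]

theorem hasPot_of.{u, v} {F : Type u} {α : Type v} [Group F] {b : α → F} (gen : Subgroup.closure (Set.range b) = ⊤)
    (lift : ∀ (G : Type u) [Group G] (f : α → G), ∃ φ : F →* G, ∀ a, φ (b a) = f a) : HasPot b := by
  intro ω
  let σ : α → Equiv.Perm (F × ℚ) := fun a =>
    { toFun := fun p => (p.1 * b a, p.2 + ω (p.1, a))
      invFun := fun p => (p.1 * (b a)⁻¹, p.2 - ω (p.1 * (b a)⁻¹, a))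
      left_inv := fun p => by simp
      right_inv := fun p => by simp }
  obtain ⟨φ, hφ⟩ := lift (Equiv.Perm (F × ℚ))ᵐᵒᵖ (fun a => MulOpposite.op (σ a))
  have hstep : ∀ x a, (φ (x * b a)).unop (1, 0) = σ a ((φ x).unop (1, 0)) := by
    intro x a
    rw [map_mul, hφ]; rfl
  have hfst : ∀ x, ((φ x).unop (1, 0)).1 = x := by
    refine gen_induction gen 1 (by simp) ?_ ?_
    · intro x a h
      rw [hstep]
      change ((φ x).unop (1, 0)).1 * b a = _
      rw [h]
    · intro x a h
      rw [hstep] at h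
      change ((φ x).unop (1, 0)).1 * b a = _ at h
      exact mul_right_cancel h
  refine ⟨fun x => ((φ x).unop (1, 0)).2, by simp, fun x a => ?_⟩
  simp only [hstep]
  change ((φ x).unop (1, 0)).2 + ω (((φ x).unop (1, 0)).1, a) = _
  rw [hfst]

theorem exists_conn_set {b : α → F} (gen : Subgroup.closure (Set.range b) = ⊤) (x : F) :
    ∃ B : Set F, B.Finite ∧ x ∈ B ∧ ∀ y ∈ B, Conn b (EW b B) 1 y := by
  have mono : ∀ {B B' : Set F}, B ⊆ B' → EW b B ⊆ EW b B' := fun h e he => ⟨h he.1, h he.2⟩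
  refine gen_induction gen (p := fun x => ∃ B : Set F, B.Finite ∧ x ∈ B ∧ ∀ y ∈ B,
    Conn b (EW b B) 1 y) 1 ⟨{1}, Set.finite_singleton 1, rfl, ?_⟩ ?_ ?_ x
  · rintro y rfl; exact Conn.rfl' _
  · rintro x a ⟨B, hB, hx, hc⟩
    refine ⟨insert (x * b a) B, hB.insert _, Set.mem_insert _ _, ?_⟩
    rintro y (rfl | hy)
    · exact ((hc x hx).mono (mono (Set.subset_insert _ _))).trans
        (conn_edge (S := EW b (insert (x * b a) B)) ⟨Or.inr hx, Or.inl rfl⟩)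
    · exact (hc y hy).mono (mono (Set.subset_insert _ _))
  · rintro x a ⟨B, hB, hx, hc⟩
    refine ⟨insert x B, hB.insert _, Set.mem_insert _ _, ?_⟩
    rintro y (rfl | hy)
    · exact ((hc _ hx).mono (mono (Set.subset_insert _ _))).trans
        (conn_edge (S := EW b (insert y B)) ⟨Or.inl rfl, Or.inr hx⟩).symm
    · exact (hc y hy).mono (mono (Set.subset_insert _ _))

/-- The union of translates `H B`. -/
def HB (H : Subgroup F) (B : Set F) : Set F := {w | ∃ h ∈ H, ∃ x ∈ B, w = h * x}

theorem exists_good {b : α → F} (gen : Subgroup.closure (Set.range b) = ⊤) {H : Subgroup F} {r : ℕ}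
    (e : FreeGroup (Fin r) ≃* H) {D : Set F} (hD : D.Finite) :
    ∃ B : Set F, B.Finite ∧ D ⊆ B ∧ Good b H (HB H B) := by
  choose C hC1 hC2 hC3 using exists_conn_set gen
  let D' : Set F := insert 1 (D ∪ Set.range fun i => ((e (FreeGroup.of i) : H) : F))
  have hD' : D'.Finite := (hD.union (Set.finite_range _)).insert _
  let B : Set F := ⋃ d ∈ D', C d
  have hsub : D' ⊆ B := fun d hd => Set.mem_biUnion hd (hC2 d)
  have hBfin : B.Finite := hD'.biUnion fun d _ => hC1 d
  have h1B : (1 : F) ∈ B := hsub (Set.mem_insert _ _)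
  have hBW : B ⊆ HB H B := fun x hx => ⟨1, H.one_mem, x, hx, by simp⟩
  have hinv' : ∀ h ∈ H, ∀ x ∈ HB H B, h * x ∈ HB H B := by
    rintro h hh _ ⟨k, hk, x, hx, rfl⟩
    exact ⟨h * k, H.mul_mem hh hk, x, hx, by rw [mul_assoc]⟩
  have hinv : ∀ h ∈ H, ∀ x, h * x ∈ HB H B ↔ x ∈ HB H B := fun h hh x =>
    ⟨fun hx => by simpa using hinv' h⁻¹ (H.inv_mem hh) _ hx, hinv' h hh x⟩
  have htr : ∀ h ∈ H, ∀ {x y}, Conn b (EW b (HB H B)) x y → Conn b (EW b (HB H B)) (h * x) (h * y) :=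
    fun h hh x y hc => hc.map h fun z a hz =>
      tr_EW (g := h) (e := (z, a)) (hinv' h hh) hz
  have hcB : ∀ x ∈ B, Conn b (EW b (HB H B)) 1 x := by
    intro x hx
    obtain ⟨d, hd, hx⟩ := Set.mem_iUnion₂.1 hx
    refine (hC3 d x hx).mono ?_
    have : C d ⊆ HB H B := fun z hz => hBW (Set.mem_biUnion hd hz)
    exact fun f hf => ⟨this hf.1, this hf.2⟩
  have hcH : ∀ y : FreeGroup (Fin r), Conn b (EW b (HB H B)) 1 ((e y : H) : F) := by
    intro y
    induction y using FreeGroup.induction_on with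
    | C1 => simpa using Conn.rfl' _
    | of i => exact hcB _ (hsub (Or.inr (Or.inr ⟨i, rfl⟩)))
    | inv_of i h =>
      have := htr _ (H.inv_mem (e (FreeGroup.of i)).2) h
      simpa using this.symm
    | mul x y hx hy =>
      have := htr _ (e x).2 hy
      rw [mul_one] at this
      simpa using hx.trans this
  have hc1 : ∀ w ∈ HB H B, Conn b (EW b (HB H B)) 1 w := by
    rintro _ ⟨h, hh, x, hx, rfl⟩
    have h1 := hcH (e.symm ⟨h, hh⟩)
    rw [MulEquiv.apply_symm_apply] at h1
    have h2 := htr h hh (hcB x hx)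
    rw [mul_one] at h2
    exact h1.trans h2
  refine ⟨B, hBfin, fun d hd => hsub (Or.inr (Or.inl hd)), ⟨hBW h1B, hinv, ?_, ?_⟩⟩
  · intro x hx y hy
    exact (hc1 x hx).symm.trans (hc1 y hy)
  · refine (hBfin.image (cls H)).subset ?_
    intro q hq
    obtain ⟨h, hh, x, hx, he⟩ := hq
    refine ⟨x, hx, ?_⟩
    rw [← cls_out q]
    exact cls_eq'.2 ⟨h, hh, he⟩

theorem sep_finite {b : α → F} (gen : Subgroup.closure (Set.range b) = ⊤) (x y : F) :
    {e | ¬ Conn b {e}ᶜ x y}.Finite := by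
  refine gen_induction gen (p := fun y => {e | ¬ Conn b {e}ᶜ x y}.Finite) x ?_ ?_ ?_ y
  · convert Set.finite_empty
    ext e; simp [Conn.rfl']
  · intro y a h
    refine (h.insert (y, a)).subset fun e he => ?_
    by_cases h' : e = (y, a)
    · exact Or.inl h'
    · refine Or.inr fun hc => he (hc.trans (conn_edge ?_))
      exact fun h'' => h' h''.symm
  · intro y a h
    refine (h.insert (y, a)).subset fun e he => ?_
    by_cases h' : e = (y, a)
    · exact Or.inl h'
    · refine Or.inr fun hc => he (hc.trans (Conn.symm (conn_edge ?_)))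
      exact fun h'' => h' h''.symm

theorem exists_sep {b : α → F} (gen : Subgroup.closure (Set.range b) = ⊤) (pot : HasPot b) {W : Set F}
    (h1 : 1 ∈ W) (hc : ∀ x ∈ W, ∀ y ∈ W, Conn b (EW b W) x y) (y : F) :
    y ∈ W ∨ ∃ e : F × α, ¬ (e.1 ∈ W ↔ e.1 * b e.2 ∈ W) ∧ ¬ Conn b {e}ᶜ 1 y := by
  have hW : ∀ e : F × α, ¬ (e.1 ∈ W ↔ e.1 * b e.2 ∈ W) → EW b W ⊆ {e}ᶜ := by
    rintro e he f hf rfl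
    exact he ⟨fun _ => hf.2, fun _ => hf.1⟩
  refine gen_induction gen (p := fun y => y ∈ W ∨ ∃ e : F × α,
    ¬ (e.1 ∈ W ↔ e.1 * b e.2 ∈ W) ∧ ¬ Conn b {e}ᶜ 1 y) 1 (Or.inl h1) ?_ ?_ y
  · intro y a h
    by_cases hy' : y * b a ∈ W
    · exact Or.inl hy'
    refine Or.inr ?_
    by_cases hy : y ∈ W
    · have hn : ¬ (y ∈ W ↔ y * b a ∈ W) := by tauto
      exact ⟨(y, a), hn, fun hcc => not_conn pot (y, a)
        (((hc y hy 1 h1).mono (hW (y, a) hn)).trans hcc)⟩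
    · obtain ⟨e, he, hcc⟩ := h.resolve_left hy
      refine ⟨e, he, fun h' => hcc (h'.trans (Conn.symm (conn_edge ?_)))⟩
      rintro rfl
      exact he (by tauto)
  · intro y a h
    by_cases hy' : y ∈ W
    · exact Or.inl hy'
    refine Or.inr ?_
    by_cases hy : y * b a ∈ W
    · have hn : ¬ (y ∈ W ↔ y * b a ∈ W) := by tauto
      exact ⟨(y, a), hn, fun hcc => not_conn pot (y, a)
        (hcc.symm.trans ((hc 1 h1 _ hy).mono (hW (y, a) hn)))⟩
    · obtain ⟨e, he, hcc⟩ := h.resolve_left hy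
      refine ⟨e, he, fun h' => hcc (h'.trans (conn_edge ?_))⟩
      rintro rfl
      exact he (by tauto)

theorem meet {b : α → F} (gen : Subgroup.closure (Set.range b) = ⊤) (pot : HasPot b) {W W' : Set F}
    (h1 : 1 ∈ W) (hc : ∀ x ∈ W, ∀ y ∈ W, Conn b (EW b W) x y)
    (hc' : ∀ x ∈ W', ∀ y ∈ W', Conn b (EW b W') x y) {g t : F}
    (hg : Function.Injective fun n : ℕ => g ^ n)
    (hgW : ∀ n : ℕ, (g ^ n)⁻¹ ∈ W) (ht : t ∈ W') (hgW' : ∀ n : ℕ, (g ^ n)⁻¹ * t ∈ W') :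
    ∃ w, w ∈ W ∧ w ∈ W' := by
  by_contra! hdis
  obtain ⟨e, he, hsep⟩ := (exists_sep gen pot h1 hc t).resolve_left fun h => hdis _ h ht
  have hW : EW b W ⊆ {e}ᶜ := by
    rintro f hf rfl
    exact he ⟨fun _ => hf.2, fun _ => hf.1⟩
  have hW' : EW b W' ⊆ {e}ᶜ := by
    rintro f hf rfl
    exact he ⟨fun h => absurd hf.1 (hdis _ h), fun h => absurd hf.2 (hdis _ h)⟩
  have hall : ∀ n : ℕ, tr (g ^ n) e ∈ {e | ¬ Conn b {e}ᶜ 1 t} := by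
    intro n hcc
    have h2 : Conn b {e}ᶜ ((g ^ n)⁻¹ * 1) ((g ^ n)⁻¹ * t) := hcc.map _ fun x a hx => by
      intro hx'
      apply hx
      have hx' : ((g ^ n)⁻¹ * x, a) = e := hx'
      rw [← hx']
      simp [tr]
    rw [mul_one] at h2
    exact hsep ((((hc _ h1 _ (hgW n)).mono hW).trans h2).trans
      ((hc' _ (hgW' n) _ ht).mono hW'))
  refine Set.infinite_of_injective_forall_mem (f := fun n : ℕ => tr (g ^ n) e) ?_ hall
    (sep_finite gen 1 t)
  intro n m h
  exact hg (mul_right_cancel (congrArg Prod.fst h))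

theorem mem_conj {s x : F} {H : Subgroup F} : x ∈ conjSubgroup s H ↔ s⁻¹ * x * s ∈ H := by
  constructor
  · rintro ⟨y, hy, rfl⟩
    simpa [mul_assoc] using hy
  · intro h
    exact ⟨_, h, by simp [mul_assoc]⟩

theorem ne_bot_iff {H₁ H₂ : Subgroup F} {t : F} : H₁ ⊓ conjSubgroup t H₂ ≠ ⊥ ↔
    ∃ g, g ≠ 1 ∧ g ∈ H₁ ∧ t⁻¹ * g * t ∈ H₂ := by
  rw [Subgroup.ne_bot_iff_exists_ne_one]
  constructor
  · rintro ⟨⟨g, hg⟩, hne⟩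
    exact ⟨g, fun h => hne (Subtype.ext h), hg.1, mem_conj.1 hg.2⟩
  · rintro ⟨g, hne, h1, h2⟩
    exact ⟨⟨g, h1, mem_conj.2 h2⟩, fun h => hne (congrArg Subtype.val h)⟩

theorem SameDoset.symm' {H₁ H₂ : Subgroup F} {s t : F} (h : SameDoset H₁ H₂ s t) :
    SameDoset H₁ H₂ t s := by
  obtain ⟨h₁, m₁, h₂, m₂, rfl⟩ := h
  exact ⟨h₁⁻¹, H₁.inv_mem m₁, h₂⁻¹, H₂.inv_mem m₂, by group⟩

theorem SameDoset.trans' {H₁ H₂ : Subgroup F} {s t u : F} (h : SameDoset H₁ H₂ s t)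
    (h' : SameDoset H₁ H₂ t u) : SameDoset H₁ H₂ s u := by
  obtain ⟨h₁, m₁, h₂, m₂, rfl⟩ := h
  obtain ⟨k₁, n₁, k₂, n₂, rfl⟩ := h'
  exact ⟨k₁ * h₁, H₁.mul_mem n₁ m₁, h₂ * k₂, H₂.mul_mem m₂ n₂, by group⟩

theorem SameDoset.ne_bot {H₁ H₂ : Subgroup F} {s t : F} (h : SameDoset H₁ H₂ s t)
    (hs : H₁ ⊓ conjSubgroup s H₂ ≠ ⊥) : H₁ ⊓ conjSubgroup t H₂ ≠ ⊥ := by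
  obtain ⟨h₁, m₁, h₂, m₂, rfl⟩ := h
  obtain ⟨g, hg, hg1, hg2⟩ := ne_bot_iff.1 hs
  refine ne_bot_iff.2 ⟨h₁ * g * h₁⁻¹, ?_, H₁.mul_mem (H₁.mul_mem m₁ hg1) (H₁.inv_mem m₁), ?_⟩
  · intro h
    exact hg (conj_eq_one_iff.1 h)
  · have := H₂.mul_mem (H₂.mul_mem (H₂.inv_mem m₂) hg2) m₂
    convert this using 1
    group

/-- Same double coset as a setoid. -/
def dosetSetoid (H₁ H₂ : Subgroup F) : Setoid F where
  r := SameDoset H₁ H₂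
  iseqv := ⟨fun x => ⟨1, H₁.one_mem, 1, H₂.one_mem, by simp⟩, SameDoset.symm', SameDoset.trans'⟩

theorem exists_transversal {H₁ H₂ : Subgroup F} {P : Set F} (hP : P.Finite)
    (h : ∀ t, H₁ ⊓ conjSubgroup t H₂ ≠ ⊥ → ∃ p ∈ P, SameDoset H₁ H₂ p t) :
    ∃ S : Set F, S.Finite ∧ IsDosetTransversal H₁ H₂ S := by
  let T : Set F := {t | H₁ ⊓ conjSubgroup t H₂ ≠ ⊥}
  let π : F → Quotient (dosetSetoid H₁ H₂) := fun x => Quotient.mk _ x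
  have hπ : ∀ {x y}, π x = π y ↔ SameDoset H₁ H₂ x y := fun {x y} => Quotient.eq
  have hout : ∀ q, π q.out = q := fun q => Quotient.out_eq q
  have hfin : (π '' T).Finite := (hP.image π).subset (by
    rintro _ ⟨t, ht, rfl⟩
    obtain ⟨p, hp, hpt⟩ := h t ht
    exact ⟨p, hp, hπ.2 hpt⟩)
  refine ⟨Quotient.out '' (π '' T), hfin.image _, ?_, ?_, ?_⟩
  · rintro _ ⟨_, ⟨t, ht, rfl⟩, rfl⟩
    exact SameDoset.ne_bot (hπ.1 (hout (π t)).symm) ht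
  · rintro _ ⟨q, -, rfl⟩ _ ⟨q', -, rfl⟩ hs
    have := hπ.2 hs
    rw [hout, hout] at this
    rw [this]
  · intro t ht
    exact ⟨_, ⟨_, ⟨t, ht, rfl⟩, rfl⟩, hπ.1 (hout (π t))⟩

variable [LinearOrder F]

theorem pow_inj (hord : ∀ x y z : F, y < z → x * y < x * z) {g : F} (hg : g ≠ 1) :
    Function.Injective fun n : ℕ => g ^ n := by
  rcases lt_or_gt_of_ne hg with h | h
  · exact (strictAnti_nat_of_succ_lt (f := fun n : ℕ => g ^ n) fun n => by
      have := hord (g ^ n) _ _ h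
      rwa [mul_one, ← pow_succ] at this).injective
  · exact (strictMono_nat_of_lt_succ (f := fun n : ℕ => g ^ n) fun n => by
      have := hord (g ^ n) _ _ h
      rwa [mul_one, ← pow_succ] at this).injective

theorem Good.infinite {b : α → F} (hord : ∀ x y z : F, y < z → x * y < x * z) {H : Subgroup F}
    {W : Set F} (hW : Good b H W) {g : F} (hg : g ∈ H) (hne : g ≠ 1) : W.Infinite :=
  Set.infinite_of_injective_forall_mem (pow_inj hord hne) fun n => by
    simpa using (hW.inv (g ^ n) (H.pow_mem hg n) 1).2 hW.one

theorem finite_dosets {b : α → F} (gen : Subgroup.closure (Set.range b) = ⊤) (pot : HasPot b)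
    (hord : ∀ x y z : F, y < z → x * y < x * z) (H₁ H₂ : Subgroup F) {r₁ r₂ : ℕ}
    (e₁ : FreeGroup (Fin r₁) ≃* H₁) (e₂ : FreeGroup (Fin r₂) ≃* H₂) :
    ∃ S : Set F, S.Finite ∧ IsDosetTransversal H₁ H₂ S := by
  obtain ⟨B₁, hB₁, -, hW₁⟩ := exists_good gen e₁ Set.finite_empty
  obtain ⟨B₂, hB₂, -, hW₂⟩ := exists_good gen e₂ Set.finite_empty
  refine exists_transversal (P := Set.image2 (fun x y => x * y⁻¹) B₁ B₂) (hB₁.image2 _ hB₂) ?_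
  intro t ht
  obtain ⟨g, hne, hg1, hg2⟩ := ne_bot_iff.1 ht
  obtain ⟨w, hw1, w', hw2, rfl⟩ := meet gen pot (W' := (t * ·) '' HB H₂ B₂) (g := g) (t := t)
    hW₁.one hW₁.conn (by
      rintro _ ⟨x, hx, rfl⟩ _ ⟨y, hy, rfl⟩
      exact (hW₂.conn x hx y hy).map t fun z a hz =>
        tr_EW (g := t) (e := (z, a)) (fun x hx => Set.mem_image_of_mem (t * ·) hx) hz) (pow_inj hord hne)
    (fun n => by simpa using (hW₁.inv _ (H₁.inv_mem (H₁.pow_mem hg1 n)) 1).2 hW₁.one)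
    ⟨1, hW₂.one, by simp⟩
    (fun n => ⟨((t⁻¹ * g * t) ^ n)⁻¹, by
      simpa using (hW₂.inv _ (H₂.inv_mem (H₂.pow_mem hg2 n)) 1).2 hW₂.one, by
      have : (t⁻¹ * g * t) ^ n = t⁻¹ * g ^ n * t := by
        have := conj_pow (i := n) (a := t⁻¹) (b := g)
        rwa [inv_inv] at this
      simp only [this]; group⟩)
  obtain ⟨h, hh, x, hx, e1⟩ := hw1
  obtain ⟨k, hk, y, hy, rfl⟩ := hw2
  refine ⟨x * y⁻¹, ⟨x, hx, y, hy, rfl⟩, h, hh, k⁻¹, H₂.inv_mem hk, ?_⟩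
  simp only at e1
  have : t = h * x * (k * y)⁻¹ := by rw [← e1]; group
  rw [this]; group

variable [LinearOrder α]

theorem bridges_card {b : α → F} (gen : Subgroup.closure (Set.range b) = ⊤) (pot : HasPot b)
    (hord : ∀ x y z : F, y < z → x * y < x * z) {H : Subgroup F} {r : ℕ}
    (e : FreeGroup (Fin r) ≃* H) {W : Set F} (hW : Good b H W) (hne : ∃ g ∈ H, g ≠ 1) :
    (Bb b H W).Finite ∧ (Bb b H W).ncard = r - 1 := by
  obtain ⟨g, hg, hg1⟩ := hne
  obtain ⟨hE, he⟩ := euler gen pot hW e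
  have := count_bridges pot hord hW hE (hW.infinite hord hg hg1)
  exact ⟨hE.subset fun p hp => hp.1, by omega⟩

theorem Br.cls_mem {b : α → F} (hord : ∀ x y z : F, y < z → x * y < x * z) {H : Subgroup F}
    {W W' : Set F} (hW' : Good b H W') {g x : F} {a : α} (hsub : ∀ w ∈ W, g * w ∈ W')
    (h : Br b W (x, a)) : (cls H (g * x), a) ∈ Bb b H W' := by
  obtain ⟨k, hk, he⟩ := out_cls H (g * x)
  change Br b W' ((cls H (g * x)).out, a)
  rw [he, ← mul_assoc]
  exact Br.tr (g := k * g) (e := (x, a)) hord (fun w hw => by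
    rw [mul_assoc]; exact (hW'.inv k hk _).2 (hsub w hw)) h

theorem final_ineq {b : α → F} (gen : Subgroup.closure (Set.range b) = ⊤) (pot : HasPot b)
    (hord : ∀ x y z : F, y < z → x * y < x * z) (H₁ H₂ : Subgroup F) {r₁ r₂ : ℕ}
    (e₁ : FreeGroup (Fin r₁) ≃* H₁) (e₂ : FreeGroup (Fin r₂) ≃* H₂) (S : Finset F)
    (hS : IsDosetTransversal H₁ H₂ (S : Set F)) (n : F → ℕ)
    (hn : ∀ s ∈ S, Nonempty (FreeGroup (Fin (n s)) ≃* ↥(H₁ ⊓ conjSubgroup s H₂))) :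
    ∑ s ∈ S, (n s - 1) ≤ (r₁ - 1) * (r₂ - 1) := by
  classical
  rcases S.eq_empty_or_nonempty with rfl | ⟨s₀, hs₀⟩
  · simp
  obtain ⟨g, hg, hg1, hg2⟩ := ne_bot_iff.1 (hS.1 s₀ hs₀)
  have hex : ∀ s, ∃ B : Set F, s ∈ S → B.Finite ∧
      Good b (H₁ ⊓ conjSubgroup s H₂) (HB (H₁ ⊓ conjSubgroup s H₂) B) := by
    intro s
    by_cases hs : s ∈ S
    · obtain ⟨e⟩ := hn s hs
      obtain ⟨B, hB, -, hW⟩ := exists_good gen e Set.finite_empty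
      exact ⟨B, fun _ => ⟨hB, hW⟩⟩
    · exact ⟨∅, fun h => absurd h hs⟩
  choose B hB using hex
  obtain ⟨B₁, -, hD₁, hW₁⟩ := exists_good gen e₁ (D := ⋃ s ∈ S, B s)
    (S.finite_toSet.biUnion fun s hs => (hB s hs).1)
  obtain ⟨B₂, -, hD₂, hW₂⟩ := exists_good gen e₂ (D := ⋃ s ∈ S, (s⁻¹ * ·) '' B s)
    (S.finite_toSet.biUnion fun s hs => (hB s hs).1.image _)
  obtain ⟨hf₁, hc₁⟩ := bridges_card gen pot hord e₁ hW₁ ⟨g, hg1, hg⟩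
  obtain ⟨hf₂, hc₂⟩ := bridges_card gen pot hord e₂ hW₂ ⟨_, hg2, fun h => hg (by
    have h' : s₀⁻¹ * g * s₀⁻¹⁻¹ = 1 := by rwa [inv_inv]
    exact conj_eq_one_iff.1 h')⟩
  have hL : ∀ s ∈ S, (Bb b (H₁ ⊓ conjSubgroup s H₂) (HB (H₁ ⊓ conjSubgroup s H₂) (B s))).Finite ∧
      (Bb b (H₁ ⊓ conjSubgroup s H₂) (HB (H₁ ⊓ conjSubgroup s H₂) (B s))).ncard = n s - 1 := by
    intro s hs
    obtain ⟨e⟩ := hn s hs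
    obtain ⟨k, hk, hk1, hk2⟩ := ne_bot_iff.1 (hS.1 s hs)
    exact bridges_card gen pot hord e (hB s hs).2 ⟨k, ⟨hk1, mem_conj.2 hk2⟩, hk⟩
  have hsub₁ : ∀ s ∈ S, ∀ w ∈ HB (H₁ ⊓ conjSubgroup s H₂) (B s), 1 * w ∈ HB H₁ B₁ := by
    rintro s hs _ ⟨h, hh, x, hx, rfl⟩
    exact ⟨h, hh.1, x, hD₁ (Set.mem_biUnion hs hx), by simp⟩
  have hsub₂ : ∀ s ∈ S, ∀ w ∈ HB (H₁ ⊓ conjSubgroup s H₂) (B s), s⁻¹ * w ∈ HB H₂ B₂ := by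
    rintro s hs _ ⟨h, hh, x, hx, rfl⟩
    exact ⟨_, mem_conj.1 hh.2, s⁻¹ * x, hD₂ (Set.mem_biUnion hs ⟨x, hx, rfl⟩), by group⟩
  let X : (s : F) → Finset (Q (H₁ ⊓ conjSubgroup s H₂) × α) := fun s =>
    if hs : s ∈ S then (hL s hs).1.toFinset else ∅
  have hX : ∀ s ∈ S, ∀ p, p ∈ X s ↔
      p ∈ Bb b (H₁ ⊓ conjSubgroup s H₂) (HB (H₁ ⊓ conjSubgroup s H₂) (B s)) := by
    intro s hs p
    simp [X, hs]
  have hXc : ∀ s ∈ S, (X s).card = n s - 1 := by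
    intro s hs
    rw [← (hL s hs).2, Set.ncard_eq_toFinset_card _ (hL s hs).1]
    simp [X, hs]
  calc ∑ s ∈ S, (n s - 1) = (S.sigma X).card := by
        rw [Finset.card_sigma]; exact Finset.sum_congr rfl fun s hs => (hXc s hs).symm
    _ ≤ (hf₁.toFinset ×ˢ hf₂.toFinset).card := by
        refine Finset.card_le_card_of_injOn
          (fun p => ((cls H₁ (1 * p.2.1.out), p.2.2), (cls H₂ (p.1⁻¹ * p.2.1.out), p.2.2))) ?_ ?_
        · rintro ⟨s, q, a⟩ hp
          rw [Finset.mem_coe, Finset.mem_sigma] at hp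
          obtain ⟨hs, hp⟩ := hp
          have hp := (hX s hs _).1 hp
          simp only [Finset.mem_coe, Finset.mem_product, Set.Finite.mem_toFinset]
          exact ⟨Br.cls_mem hord hW₁ (hsub₁ s hs) hp, Br.cls_mem hord hW₂ (hsub₂ s hs) hp⟩
        · rintro ⟨s, q, a⟩ hp ⟨s', q', a'⟩ hp' heq
          rw [Finset.mem_coe, Finset.mem_sigma] at hp hp'
          simp only [Prod.mk.injEq] at heq
          obtain ⟨⟨h1, rfl⟩, h2, -⟩ := heq
          obtain ⟨k, hk, e1⟩ := cls_eq'.1 h1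
          obtain ⟨l, hl, e2⟩ := cls_eq'.1 h2
          rw [one_mul, one_mul] at e1
          have e3 : s' = k * s * l⁻¹ := by
            rw [e1] at e2
            have e4 : s'⁻¹ * k = l * s⁻¹ := by
              apply mul_right_cancel (b := q.out)
              simpa [mul_assoc] using e2
            have e5 : s' = k * (s'⁻¹ * k)⁻¹ := by group
            rw [e5, e4]; group
          have : s = s' := hS.2.1 s hp.1 s' hp'.1 ⟨k, hk, l⁻¹, H₂.inv_mem hl, e3⟩
          subst this
          have : q = q' := by
            rw [← cls_out q, ← cls_out q']
            refine cls_eq'.2 ⟨k, ⟨hk, mem_conj.2 ?_⟩, e1⟩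
            have e4 : s⁻¹ * k * s = l := by
              have : k = s * l * s⁻¹ := by
                calc k = (k * s * l⁻¹) * l * s⁻¹ := by group
                  _ = s * l * s⁻¹ := by rw [← e3]
              rw [this]; group
            rwa [e4]
          rw [this]
    _ = (r₁ - 1) * (r₂ - 1) := by
        rw [Finset.card_product, ← Set.ncard_eq_toFinset_card _ hf₁,
          ← Set.ncard_eq_toFinset_card _ hf₂, hc₁, hc₂]

end Final

theorem closure_range_gen (F : Type*) [Group F] [IsFreeGroup F] :
    Subgroup.closure (Set.range (IsFreeGroup.of : IsFreeGroup.Generators F → F)) = ⊤ := by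
  set K := Subgroup.closure (Set.range (IsFreeGroup.of : IsFreeGroup.Generators F → F)) with hK
  let φ : F →* K := IsFreeGroup.lift fun a => ⟨IsFreeGroup.of a, Subgroup.subset_closure ⟨a, rfl⟩⟩
  have h : K.subtype.comp φ = MonoidHom.id F := by
    apply IsFreeGroup.ext_hom
    intro a
    simp [φ]
  rw [eq_top_iff]
  intro x _
  have := DFunLike.congr_fun h x
  change ((φ x : K) : F) = x at this
  rw [← this]
  exact (φ x).2

theorem hasPot_gen (F : Type*) [Group F] [IsFreeGroup F] :
    HasPot (IsFreeGroup.of : IsFreeGroup.Generators F → F) :=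
  hasPot_of (closure_range_gen F) fun _ _ f => ⟨IsFreeGroup.lift f, fun a => IsFreeGroup.lift_of f a⟩

end SHN

/-- **Strengthened Hanna Neumann conjecture.** Let `H₁`, `H₂` be finitely generated
subgroups of a free group `F` (free of ranks `r₁`, `r₂`). Then there are only finitely
many double cosets `H₁ t H₂` with `H₁ ∩ t H₂ t⁻¹ ≠ {1}`, and for any set `S` of
representatives of these double cosets,
`Σ_{s ∈ S} r̄(H₁ ∩ s H₂ s⁻¹) ≤ r̄(H₁) ⬝ r̄(H₂)` (reduced ranks, natural subtraction). -/
theorem strengthened_hanna_neumann {F : Type*} [Group F] [IsFreeGroup F]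
    (H₁ H₂ : Subgroup F) (r₁ r₂ : ℕ)
    (e₁ : FreeGroup (Fin r₁) ≃* H₁) (e₂ : FreeGroup (Fin r₂) ≃* H₂) :
    (∃ S : Set F, S.Finite ∧ IsDosetTransversal H₁ H₂ S) ∧
    (∀ S : Finset F, IsDosetTransversal H₁ H₂ ↑S →
      ∀ n : F → ℕ,
        (∀ s ∈ S, Nonempty (FreeGroup (Fin (n s)) ≃* ↥(H₁ ⊓ conjSubgroup s H₂))) →
        ∑ s ∈ S, (n s - 1) ≤ (r₁ - 1) * (r₂ - 1)) := by
  classical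
  obtain ⟨o, ho⟩ := SHN.exists_left_order F
  letI : LinearOrder F := o
  letI : LinearOrder (IsFreeGroup.Generators F) := linearOrderOfSTO WellOrderingRel
  have hord : ∀ x y z : F, y < z → x * y < x * z := ho
  exact ⟨SHN.finite_dosets (SHN.closure_range_gen F) (SHN.hasPot_gen F) hord H₁ H₂ e₁ e₂,
    fun S hS n hn => SHN.final_ineq (SHN.closure_range_gen F) (SHN.hasPot_gen F) hord H₁ H₂ e₁ e₂
      S hS n hn⟩
end
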